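/- Let C ⊂ 𝕋² be a smooth curve with nowhere-vanishing curvature. There exist constants C₀ > 0 and λ₀ > 0, depending only on C, such that for every λ ≥ λ₀ and every real-valued eigenfunction F of the Laplacian on 𝕋² with eigenvalue λ², the restriction L⁴ norm satisfies ∫_C |F|⁴ ≤ C₀·B_λ·‖F‖₂⁴, i.e. ‖F‖_{L⁴(C)} ≤ C₀^{1/4}·B_λ^{1/4}·‖F‖₂. -/

import Mathlib

open MeasureTheory Real

noncomputable section

/-- The Euclidean norm of a vector in `ℝ × ℝ`. -/
def e2 (x : ℝ × ℝ) : ℝ := Real.sqrt (x.1 ^ 2 + x.2 ^ 2)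

/-- The integer vector `μ` viewed as a vector in `ℝ × ℝ`. -/
def iv (μ : ℤ × ℤ) : ℝ × ℝ := ((μ.1 : ℝ), (μ.2 : ℝ))

/-- The set of lattice points on the circle of radius `lam`. -/
def Elat (lam : ℝ) : Finset (ℤ × ℤ) := by
  classical
  exact (Finset.Icc (-⌈lam⌉, -⌈lam⌉) (⌈lam⌉, ⌈lam⌉)).filter
    (fun μ => (μ.1 : ℝ) ^ 2 + (μ.2 : ℝ) ^ 2 = lam ^ 2)

/-- `B_lam`: the maximal number of lattice points on the circle of radius `lam`
lying in an arc of length `√lam`. -/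
def Bmax (lam : ℝ) : ℕ := by
  classical
  exact sSup {n : ℕ | ∃ x : ℝ × ℝ, e2 x = lam ∧
    n = ((Elat lam).filter fun ξ => e2 (iv ξ - x) ≤ Real.sqrt lam).card}

/-- The eigenfunction `F(x) = ∑_{μ ∈ E_lam} a_μ e^{i⟨μ,x⟩}` of the Laplacian on the torus
`ℝ²/(2πℤ²)` with eigenvalue `lam²`. -/
def efn (lam : ℝ) (a : ℤ × ℤ → ℂ) (x : ℝ × ℝ) : ℂ :=
  ∑ μ ∈ Elat lam, a μ *
    Complex.exp (Complex.I * Complex.ofReal ((μ.1 : ℝ) * x.1 + (μ.2 : ℝ) * x.2))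

/-- The `L²` norm of `F` over the torus, realized as the square `[0,2π]²`. -/
def l2T (F : ℝ × ℝ → ℂ) : ℝ :=
  Real.sqrt (∫ x in (Set.Icc (0:ℝ) (2 * π)) ×ˢ (Set.Icc (0:ℝ) (2 * π)), ‖F x‖ ^ 2)


/-- The Gaussian integers of norm `n`. -/
def gaussSphere (n : ℕ) : Set GaussianInt := {z | z.norm = n}

theorem gaussSphere_finite (n : ℕ) : (gaussSphere n).Finite := by
  refine Set.Finite.subset (((Set.finite_Icc (-(n : ℤ)) n).prod (Set.finite_Icc (-(n : ℤ)) n)).image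
    (fun q : ℤ × ℤ => (⟨q.1, q.2⟩ : GaussianInt))) ?_
  intro z hz
  have h : z.re * z.re + z.im * z.im = n := by
    have := hz
    simp only [gaussSphere, Set.mem_ofPred_eq, Zsqrtd.norm_def] at this
    linarith
  refine ⟨(z.re, z.im), ?_, rfl⟩
  simp only [Set.mem_prod, Set.mem_Icc]
  refine ⟨⟨?_, ?_⟩, ?_, ?_⟩ <;> nlinarith [mul_self_nonneg z.re, mul_self_nonneg z.im]

theorem exists_gaussian_prime_dvd {p : ℕ} (hp : p.Prime) :
    ∃ ϖ : GaussianInt, Prime ϖ ∧ ϖ ∣ (p : GaussianInt) ∧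
      ∃ j, 1 ≤ j ∧ ϖ.norm = (p : ℤ) ^ j := by
  have hnu : ¬ IsUnit (p : GaussianInt) := by
    rw [← Zsqrtd.norm_eq_one_iff, Zsqrtd.norm_natCast, Int.natAbs_mul, Int.natAbs_natCast]
    intro h
    exact hp.one_lt.ne' (Nat.eq_one_of_mul_eq_one_right h)
  have h0 : (p : GaussianInt) ≠ 0 := by exact_mod_cast hp.ne_zero
  obtain ⟨ϖ, hϖ, hd⟩ := WfDvdMonoid.exists_irreducible_factor hnu h0
  refine ⟨ϖ, hϖ.prime, hd, ?_⟩
  obtain ⟨y, hy⟩ := hd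
  have hN : ϖ.norm.natAbs ∣ p ^ 2 := by
    have := congrArg Zsqrtd.norm hy
    rw [Zsqrtd.norm_natCast, Zsqrtd.norm_mul] at this
    refine ⟨y.norm.natAbs, ?_⟩
    rw [← Int.natAbs_mul, ← this, Int.natAbs_mul, Int.natAbs_natCast, sq]
  obtain ⟨j, -, hj⟩ := (Nat.dvd_prime_pow hp).1 hN
  refine ⟨j, ?_, ?_⟩
  · rcases Nat.eq_zero_or_pos j with rfl | h
    · exact absurd (Zsqrtd.norm_eq_one_iff.1 (by simpa using hj)) hϖ.not_isUnit
    · exact h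
  · rw [← GaussianInt.abs_natCast_norm, hj]
    push_cast
    rfl

theorem gaussian_factor_out {p m : ℕ} (hp : p.Prime) (hm : ¬ p ∣ m) {ϖ : GaussianInt}
    (hϖ : Prime ϖ) (hd : ϖ ∣ (p : GaussianInt)) {j : ℕ} (hj : 1 ≤ j)
    (hN : ϖ.norm = (p : ℤ) ^ j) (k : ℕ) :
    ∀ z : GaussianInt, z.norm = (p : ℤ) ^ k * m →
      ∃ (a b : ℕ) (w : GaussianInt), z = ϖ ^ a * star ϖ ^ b * w ∧ j * (a + b) = k ∧
        w.norm = m := by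
  induction k using Nat.strong_induction_on with
  | _ k ih =>
  intro z hz
  rcases Nat.eq_zero_or_pos k with rfl | hk
  · exact ⟨0, 0, z, by simp, by simp, by simpa using hz⟩
  have hpz : (p : ℤ) ≠ 0 := by exact_mod_cast hp.ne_zero
  have key : ∀ (σ z' : GaussianInt), σ.norm = (p : ℤ) ^ j → z = σ * z' →
      j ≤ k ∧ z'.norm = (p : ℤ) ^ (k - j) * m := by
    intro σ z' hσ hzz
    have h1 : (p : ℤ) ^ j * z'.norm = (p : ℤ) ^ k * m := by
      rw [← hz, hzz, Zsqrtd.norm_mul, hσ]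
    have hjk : j ≤ k := by
      by_contra! hlt
      obtain ⟨d, rfl⟩ := Nat.exists_eq_add_of_lt hlt
      have h2 : (p : ℤ) ^ k * ((p : ℤ) * ((p : ℤ) ^ d * z'.norm)) = (p : ℤ) ^ k * m := by
        rw [← h1]; ring
      have h3 := mul_left_cancel₀ (pow_ne_zero k hpz) h2
      exact hm (Int.natCast_dvd_natCast.1 ⟨_, h3.symm⟩)
    refine ⟨hjk, ?_⟩
    apply mul_left_cancel₀ (pow_ne_zero j hpz)
    rw [h1, ← mul_assoc, ← pow_add, Nat.add_sub_cancel' hjk]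
  have hdiv : ϖ ∣ z * star z := by
    rw [← Zsqrtd.norm_eq_mul_conj, hz]
    push_cast
    exact (hd.trans (dvd_pow_self _ hk.ne')).mul_right _
  rcases hϖ.dvd_or_dvd hdiv with ⟨z', hz'⟩ | ⟨z', hz'⟩
  · obtain ⟨hjk, h⟩ := key ϖ z' hN hz'
    obtain ⟨a, b, w, h1, h2, h3⟩ := ih (k - j) (by omega) z' h
    refine ⟨a + 1, b, w, ?_, ?_, h3⟩
    · rw [hz', h1]; ring
    · have : j * (a + 1 + b) = j * (a + b) + j := by ring
      omega
  · have hz'' : z = star ϖ * star z' := by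
      rw [← star_star z, hz', star_mul, mul_comm]
    obtain ⟨hjk, h⟩ := key (star ϖ) (star z') (by rw [Zsqrtd.norm_conj, hN]) hz''
    obtain ⟨a, b, w, h1, h2, h3⟩ := ih (k - j) (by omega) _ h
    refine ⟨a, b + 1, w, ?_, ?_, h3⟩
    · rw [hz'', h1]; ring
    · have : j * (a + (b + 1)) = j * (a + b) + j := by ring
      omega

theorem ncard_gaussSphere_prime_pow_mul {p m : ℕ} (hp : p.Prime) (hm : ¬ p ∣ m) (k : ℕ) :
    (gaussSphere (p ^ k * m)).ncard ≤ (k + 1) * (gaussSphere m).ncard := by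
  obtain ⟨ϖ, hϖ, hd, j, hj, hN⟩ := exists_gaussian_prime_dvd hp
  have hsub : gaussSphere (p ^ k * m) ⊆ (fun q : ℕ × GaussianInt =>
      ϖ ^ q.1 * star ϖ ^ (k / j - q.1) * q.2) '' (Set.Iic k ×ˢ gaussSphere m) := by
    intro z hz
    obtain ⟨a, b, w, h1, h2, h3⟩ := gaussian_factor_out hp hm hϖ hd hj hN k z
      (by simpa [gaussSphere] using hz)
    have h4 : k / j = a + b := by
      rw [← h2]; exact Nat.mul_div_cancel_left _ hj
    refine ⟨(a, w), ⟨?_, h3⟩, ?_⟩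
    · simp only [Set.mem_Iic]
      nlinarith
    · simp [h4, h1]
  have hfin : (Set.Iic k ×ˢ gaussSphere m).Finite :=
    (Set.finite_Iic k).prod (gaussSphere_finite m)
  calc _ ≤ _ := Set.ncard_le_ncard hsub (hfin.image _)
    _ ≤ _ := Set.ncard_image_le hfin
    _ = _ := by
      rw [Set.ncard_prod]
      congr 1
      rw [← Finset.coe_Iic, Set.ncard_coe_finset, Nat.card_Iic]

theorem exists_natCast_add_one_le_mul_two_rpow {ε : ℝ} (hε : 0 < ε) :
    ∃ C : ℝ, 1 ≤ C ∧ ∀ k : ℕ, ((k : ℝ) + 1) ≤ C * (2 : ℝ) ^ (ε * k) := by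
  have hl : 0 < ε * Real.log 2 := mul_pos hε (Real.log_pos one_lt_two)
  refine ⟨1 + 1 / (ε * Real.log 2), by linarith [one_div_pos.2 hl], fun k => ?_⟩
  have h : ε * Real.log 2 * k + 1 ≤ (2 : ℝ) ^ (ε * k) := by
    rw [Real.rpow_def_of_pos two_pos]
    have := Real.add_one_le_exp (Real.log 2 * (ε * k))
    linarith [this, mul_comm ε (Real.log 2)]
  have hk : (0 : ℝ) ≤ k := k.cast_nonneg
  calc (k : ℝ) + 1 ≤ (1 + 1 / (ε * Real.log 2)) * (ε * Real.log 2 * k + 1) := by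
        have : 1 / (ε * Real.log 2) * (ε * Real.log 2 * k) = k := by field_simp
        nlinarith [one_div_pos.2 hl, mul_nonneg hl.le hk]
    _ ≤ _ := by
      apply mul_le_mul_of_nonneg_left h
      linarith [one_div_pos.2 hl]

theorem exists_ncard_gaussSphere_le {ε : ℝ} (hε : 0 < ε) :
    ∃ C : ℝ, 0 < C ∧ ∀ n : ℕ, n ≠ 0 → ((gaussSphere n).ncard : ℝ) ≤ C * (n : ℝ) ^ ε := by
  obtain ⟨C, hC1, hC⟩ := exists_natCast_add_one_le_mul_two_rpow hε
  have hC0 : 0 < C := by linarith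
  obtain ⟨M, hM⟩ := exists_nat_ge ((2 : ℝ) ^ (1 / ε))
  set F : ℝ := (gaussSphere 1).ncard + 1 with hF
  have hF0 : 0 < F := by positivity
  have main : ∀ n : ℕ, n ≠ 0 → ((gaussSphere n).ncard : ℝ) ≤
      F * C ^ (n.primeFactors.filter (· < M)).card * (n : ℝ) ^ ε := by
    intro n
    induction n using Nat.recOnPrimePow with
    | zero => intro h; exact absurd rfl h
    | one => intro _; simp [hF]
    | prime_pow_mul a p k hp hpa hk ih =>
      intro hne
      have ha : a ≠ 0 := by rintro rfl; simp at hne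
      have ih := ih ha
      have hp0 : (0 : ℝ) ≤ p := p.cast_nonneg
      have h1 : ((gaussSphere (p ^ k * a)).ncard : ℝ) ≤ (k + 1) * (gaussSphere a).ncard := by
        exact_mod_cast ncard_gaussSphere_prime_pow_mul hp hpa k
      have hpf : (p ^ k * a).primeFactors = insert p a.primeFactors := by
        rw [Nat.primeFactors_mul (pow_ne_zero _ hp.ne_zero) ha, Nat.primeFactors_prime_pow hk.ne' hp,
          Finset.insert_eq]
      have hnot : p ∉ a.primeFactors := fun h => hpa (Nat.dvd_of_mem_primeFactors h)
      have hpow : (((p ^ k * a : ℕ) : ℝ)) ^ ε = (p : ℝ) ^ (ε * k) * (a : ℝ) ^ ε := by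
        push_cast
        rw [Real.mul_rpow (by positivity) (by positivity), ← Real.rpow_natCast,
          ← Real.rpow_mul hp0, mul_comm (k : ℝ) ε]
      have step : ((k : ℝ) + 1) * C ^ (a.primeFactors.filter (· < M)).card ≤
          C ^ ((p ^ k * a).primeFactors.filter (· < M)).card * (p : ℝ) ^ (ε * k) := by
        rw [hpf, Finset.filter_insert]
        split_ifs with hpM
        · rw [Finset.card_insert_of_notMem (by simp [hnot]), pow_succ]
          have h2 : (2 : ℝ) ^ (ε * k) ≤ (p : ℝ) ^ (ε * k) :=
            Real.rpow_le_rpow (by norm_num) (by exact_mod_cast hp.two_le) (by positivity)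
          have h3 := (hC k).trans (mul_le_mul_of_nonneg_left h2 hC0.le)
          nlinarith [pow_pos hC0 (a.primeFactors.filter (· < M)).card]
        · have h2 : ((k : ℝ) + 1) ≤ (p : ℝ) ^ (ε * k) := by
            have hb : (2 : ℝ) ^ (1 / ε) ≤ p := hM.trans (by exact_mod_cast not_lt.1 hpM)
            have hb2 : (2 : ℝ) ≤ (p : ℝ) ^ ε := by
              calc (2 : ℝ) = ((2 : ℝ) ^ (1 / ε)) ^ ε := by
                    rw [← Real.rpow_mul (by norm_num), one_div_mul_cancel hε.ne', Real.rpow_one]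
                _ ≤ _ := Real.rpow_le_rpow (by positivity) hb hε.le
            rw [Real.rpow_mul hp0, Real.rpow_natCast]
            calc ((k : ℝ) + 1) ≤ 2 ^ k := by exact_mod_cast Nat.lt_two_pow_self
              _ ≤ _ := pow_le_pow_left₀ (by norm_num) hb2 k
          rw [mul_comm]
          exact mul_le_mul_of_nonneg_left h2 (by positivity)
      calc ((gaussSphere (p ^ k * a)).ncard : ℝ) ≤ (k + 1) * (gaussSphere a).ncard := h1
        _ ≤ (k + 1) * (F * C ^ (a.primeFactors.filter (· < M)).card * (a : ℝ) ^ ε) := by gcongr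
        _ = F * (((k : ℝ) + 1) * C ^ (a.primeFactors.filter (· < M)).card) * (a : ℝ) ^ ε := by ring
        _ ≤ F * (C ^ ((p ^ k * a).primeFactors.filter (· < M)).card * (p : ℝ) ^ (ε * k)) *
            (a : ℝ) ^ ε := by gcongr
        _ = _ := by rw [hpow]; ring
  refine ⟨F * C ^ M, by positivity, fun n hn => (main n hn).trans ?_⟩
  have hcard : (n.primeFactors.filter (· < M)).card ≤ M := by
    calc _ ≤ (Finset.range M).card := Finset.card_le_card (fun x hx => by
          simpa using (Finset.mem_filter.1 hx).2)
      _ = M := Finset.card_range M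
  gcongr


theorem intervalIntegral_inv_one_add_mul_sq_le {L M ρ : ℝ} {p p' p'' : ℝ → ℝ} {K D : ℝ}
    (hL : 0 < L) (hρ : 0 < ρ) (hM : 0 ≤ M)
    (hp : ∀ t, HasDerivAt p (p' t) t) (hp' : ∀ t, HasDerivAt p' (p'' t) t)
    (hc'' : Continuous p'')
    (hpp : ∀ t ∈ Set.Icc 0 L, 1 ≤ p t ^ 2 + M * p' t ^ 2)
    (hK : ∀ t ∈ Set.Icc 0 L, |p' t| ≤ K) (hD : ∀ t ∈ Set.Icc 0 L, |p'' t| ≤ D) :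
    ∫ t in (0 : ℝ)..L, 1 / (1 + ρ * p t ^ 2) ≤
      L / ρ + M * (2 * (K + K + L * D)) / √ρ := by
  have hcp : Continuous p := continuous_iff_continuousAt.2 fun t => (hp t).continuousAt
  have hcp' : Continuous p' := continuous_iff_continuousAt.2 fun t => (hp' t).continuousAt
  have hs : 0 < √ρ := Real.sqrt_pos.2 hρ
  have hss : √ρ ^ 2 = ρ := Real.sq_sqrt hρ.le
  have hden : ∀ t, 0 < 1 + ρ * p t ^ 2 := fun t => by positivity
  set v : ℝ → ℝ := fun t => arctan (√ρ * p t) / √ρ with hv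
  have hv' : ∀ t, HasDerivAt v (p' t / (1 + ρ * p t ^ 2)) t := by
    intro t
    have h := (((hp t).const_mul (√ρ)).arctan).div_const (√ρ)
    refine h.congr_deriv ?_
    rw [mul_pow, hss]
    field_simp
  have hvb : ∀ t, |v t| ≤ 2 / √ρ := by
    intro t
    rw [hv, abs_div, abs_of_pos hs]
    gcongr
    rw [abs_le]
    constructor <;> linarith [Real.arctan_lt_pi_div_two (√ρ * p t),
      Real.neg_pi_div_two_lt_arctan (√ρ * p t), Real.pi_lt_four]
  have hcv' : Continuous fun t => p' t / (1 + ρ * p t ^ 2) :=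
    hcp'.div (by fun_prop) fun t => (hden t).ne'
  have hcv : Continuous v := continuous_iff_continuousAt.2 fun t => (hv' t).continuousAt
  have hparts := intervalIntegral.integral_mul_deriv_eq_deriv_mul (a := 0) (b := L)
    (u := p') (v := v) (u' := p'') (v' := fun t => p' t / (1 + ρ * p t ^ 2))
    (fun t _ => hp' t) (fun t _ => hv' t) (hc''.intervalIntegrable _ _)
    (hcv'.intervalIntegrable _ _)
  have h0 : (0 : ℝ) ∈ Set.Icc 0 L := ⟨le_rfl, hL.le⟩
  have h1 : L ∈ Set.Icc 0 L := ⟨hL.le, le_rfl⟩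
  have hK0 : 0 ≤ K := (abs_nonneg _).trans (hK 0 h0)
  have hD0 : 0 ≤ D := (abs_nonneg _).trans (hD 0 h0)
  have hI : |∫ t in (0 : ℝ)..L, p'' t * v t| ≤ D * (2 / √ρ) * L := by
    have := intervalIntegral.norm_integral_le_of_norm_le_const (a := 0) (b := L)
      (f := fun t => p'' t * v t) (C := D * (2 / √ρ)) (fun t ht => by
        rw [Set.uIoc_of_le hL.le] at ht
        rw [norm_mul, Real.norm_eq_abs, Real.norm_eq_abs]
        exact mul_le_mul (hD t ⟨ht.1.le, ht.2⟩) (hvb t) (abs_nonneg _) hD0)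
    rwa [sub_zero, abs_of_pos hL, Real.norm_eq_abs] at this
  have hb : ∀ t ∈ Set.Icc 0 L, |p' t * v t| ≤ K * (2 / √ρ) := fun t ht => by
    rw [abs_mul]
    exact mul_le_mul (hK t ht) (hvb t) (abs_nonneg _) hK0
  have hJ : ∫ t in (0 : ℝ)..L, p' t * (p' t / (1 + ρ * p t ^ 2)) ≤
      2 * (K + K + L * D) / √ρ := by
    rw [hparts]
    have e : 2 * (K + K + L * D) / √ρ = K * (2 / √ρ) + K * (2 / √ρ) + D * (2 / √ρ) * L := by
      ring
    rw [e]
    linarith [abs_le.1 hI, abs_le.1 (hb 0 h0), abs_le.1 (hb L h1)]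
  have hpt : ∀ t ∈ Set.Icc 0 L, 1 / (1 + ρ * p t ^ 2) ≤
      1 / ρ + M * (p' t * (p' t / (1 + ρ * p t ^ 2))) := by
    intro t ht
    have h2 : p t ^ 2 / (1 + ρ * p t ^ 2) ≤ 1 / ρ := by
      rw [div_le_div_iff₀ (hden t) hρ]; nlinarith
    calc 1 / (1 + ρ * p t ^ 2) ≤ (p t ^ 2 + M * p' t ^ 2) / (1 + ρ * p t ^ 2) := by
          have := hden t
          gcongr
          exact hpp t ht
      _ = p t ^ 2 / (1 + ρ * p t ^ 2) + M * (p' t * (p' t / (1 + ρ * p t ^ 2))) := by ring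
      _ ≤ _ := by linarith
  have hcJ : Continuous fun t => M * (p' t * (p' t / (1 + ρ * p t ^ 2))) :=
    continuous_const.mul (hcp'.mul hcv')
  calc ∫ t in (0 : ℝ)..L, 1 / (1 + ρ * p t ^ 2)
      ≤ ∫ t in (0 : ℝ)..L, (1 / ρ + M * (p' t * (p' t / (1 + ρ * p t ^ 2)))) := by
        apply intervalIntegral.integral_mono_on hL.le
        · exact (continuous_const.div (by fun_prop) fun t => (hden t).ne').intervalIntegrable _ _
        · exact (continuous_const.add hcJ).intervalIntegrable _ _
        · exact hpt
    _ = L / ρ + M * ∫ t in (0 : ℝ)..L, p' t * (p' t / (1 + ρ * p t ^ 2)) := by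
        rw [intervalIntegral.integral_add (continuous_const.intervalIntegrable _ _)
          (hcJ.intervalIntegrable _ _),
          intervalIntegral.integral_const_mul, intervalIntegral.integral_const]
        simp only [sub_zero, smul_eq_mul]
        ring
    _ ≤ _ := by
        rw [mul_div_assoc]
        gcongr

/-- Phase `ρ q` with `q' = p`. -/
theorem norm_intervalIntegral_exp_le {L M ρ : ℝ} {q p p' p'' : ℝ → ℝ} {K D : ℝ}
    (hL : 0 < L) (hρ : 0 < ρ) (hM : 0 ≤ M)
    (hq : ∀ t, HasDerivAt q (p t) t)
    (hp : ∀ t, HasDerivAt p (p' t) t) (hp' : ∀ t, HasDerivAt p' (p'' t) t)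
    (hc'' : Continuous p'')
    (hpp : ∀ t ∈ Set.Icc 0 L, 1 ≤ p t ^ 2 + M * p' t ^ 2)
    (hK : ∀ t ∈ Set.Icc 0 L, |p' t| ≤ K) (hD : ∀ t ∈ Set.Icc 0 L, |p'' t| ≤ D) :
    ‖∫ t in (0 : ℝ)..L, Complex.exp (Complex.I * ((ρ * q t : ℝ) : ℂ))‖ ≤
      1 / √ρ + (1 + K) * (L / ρ + M * (2 * (K + K + L * D)) / √ρ) := by
  have hs : 0 < √ρ := Real.sqrt_pos.2 hρ
  have hss : √ρ ^ 2 = ρ := Real.sq_sqrt hρ.le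
  have hcq : Continuous q := continuous_iff_continuousAt.2 fun t => (hq t).continuousAt
  have hcp : Continuous p := continuous_iff_continuousAt.2 fun t => (hp t).continuousAt
  have hcp' : Continuous p' := continuous_iff_continuousAt.2 fun t => (hp' t).continuousAt
  have hden : ∀ t, 0 < 1 + ρ * p t ^ 2 := fun t => by positivity
  have hbase := intervalIntegral_inv_one_add_mul_sq_le hL hρ hM hp hp' hc'' hpp hK hD
  have h0 : (0 : ℝ) ∈ Set.Icc 0 L := ⟨le_rfl, hL.le⟩
  have h1 : L ∈ Set.Icc 0 L := ⟨hL.le, le_rfl⟩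
  have hK0 : 0 ≤ K := (abs_nonneg _).trans (hK 0 h0)
  set E : ℝ → ℂ := fun t => Complex.exp (Complex.I * ((ρ * q t : ℝ) : ℂ)) with hE
  have hnE : ∀ t, ‖E t‖ = 1 := fun t => by
    rw [hE]; simp only; rw [mul_comm, Complex.norm_exp_ofReal_mul_I]
  have hE' : ∀ t, HasDerivAt E (Complex.I * ((ρ * p t : ℝ) : ℂ) * E t) t := by
    intro t
    have h := ((((hq t).const_mul ρ).ofReal_comp).const_mul Complex.I).cexp
    rw [mul_comm] at h
    exact h
  have hcE : Continuous E := continuous_iff_continuousAt.2 fun t => (hE' t).continuousAt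
  -- the amplitude `p / (1 + ρ p²)`
  set h : ℝ → ℝ := fun t => p t / (1 + ρ * p t ^ 2) with hh
  set h' : ℝ → ℝ := fun t => (p' t * (1 - ρ * p t ^ 2)) / (1 + ρ * p t ^ 2) ^ 2 with hh'
  have hhd : ∀ t, HasDerivAt h (h' t) t := by
    intro t
    have := (hp t).div ((((hp t).pow 2).const_mul ρ).const_add 1) (hden t).ne'
    refine this.congr_deriv ?_
    simp only [hh']
    congr 1
    simp
    ring
  have hch' : Continuous h' :=
    (hcp'.mul (by fun_prop)).div (by fun_prop) fun t => (pow_pos (hden t) 2).ne'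
  have hch : Continuous h := continuous_iff_continuousAt.2 fun t => (hhd t).continuousAt
  have hhb : ∀ t, |h t| ≤ 1 / (2 * √ρ) := by
    intro t
    rw [hh]; simp only
    rw [abs_div, abs_of_pos (hden t), div_le_div_iff₀ (hden t) (by positivity)]
    have : ρ * p t ^ 2 = (√ρ * |p t|) ^ 2 := by rw [mul_pow, hss, sq_abs]
    rw [this]
    nlinarith [sq_nonneg (√ρ * |p t| - 1)]
  have hh'b : ∀ t ∈ Set.Icc 0 L, |h' t| ≤ K * (1 / (1 + ρ * p t ^ 2)) := by
    intro t ht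
    simp only [hh']
    rw [abs_div, abs_mul, abs_of_pos (pow_pos (hden t) 2)]
    have h2 : |1 - ρ * p t ^ 2| ≤ 1 + ρ * p t ^ 2 := by
      rw [abs_le]; constructor <;> nlinarith [mul_nonneg hρ.le (sq_nonneg (p t))]
    calc _ ≤ K * (1 + ρ * p t ^ 2) / (1 + ρ * p t ^ 2) ^ 2 := by
          gcongr
          exact hK t ht
      _ = _ := by
          have := (hden t).ne'
          field_simp
  have hparts := intervalIntegral.integral_mul_deriv_eq_deriv_mul (a := 0) (b := L)
    (u := fun t => (h t : ℂ)) (v := E) (u' := fun t => (h' t : ℂ))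
    (v' := fun t => Complex.I * ((ρ * p t : ℝ) : ℂ) * E t)
    (fun t _ => (hhd t).ofReal_comp) (fun t _ => hE' t)
    ((Complex.continuous_ofReal.comp hch').intervalIntegrable _ _)
    (Continuous.intervalIntegrable (by fun_prop) _ _)
  have hcinv : Continuous fun t => 1 / (1 + ρ * p t ^ 2) :=
    continuous_const.div (by fun_prop) fun t => (hden t).ne'
  have hsplit : ∀ t, E t = ((1 / (1 + ρ * p t ^ 2) : ℝ) : ℂ) * E t -
      Complex.I * ((h t : ℂ) * (Complex.I * ((ρ * p t : ℝ) : ℂ) * E t)) := by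
    intro t
    have e : (1 / (1 + ρ * p t ^ 2)) + h t * (ρ * p t) = 1 := by
      have := (hden t).ne'
      simp only [hh]
      field_simp
    have e2 : ((1 / (1 + ρ * p t ^ 2) : ℝ) : ℂ) + (h t : ℂ) * ((ρ * p t : ℝ) : ℂ) = 1 := by
      exact_mod_cast e
    linear_combination ((h t : ℂ) * ((ρ * p t : ℝ) : ℂ) * E t) * Complex.I_sq - E t * e2
  have hI1 : ‖∫ t in (0 : ℝ)..L, ((1 / (1 + ρ * p t ^ 2) : ℝ) : ℂ) * E t‖ ≤
      ∫ t in (0 : ℝ)..L, 1 / (1 + ρ * p t ^ 2) := by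
    apply intervalIntegral.norm_integral_le_of_norm_le hL.le _ (hcinv.intervalIntegrable _ _)
    refine Filter.Eventually.of_forall fun t _ => ?_
    rw [norm_mul, hnE, mul_one, Complex.norm_real, Real.norm_eq_abs,
      abs_of_pos (one_div_pos.2 (hden t))]
  have hI2 : ‖∫ t in (0 : ℝ)..L, (h' t : ℂ) * E t‖ ≤
      ∫ t in (0 : ℝ)..L, K * (1 / (1 + ρ * p t ^ 2)) := by
    apply intervalIntegral.norm_integral_le_of_norm_le hL.le _
      ((continuous_const.mul hcinv).intervalIntegrable _ _)
    refine Filter.Eventually.of_forall fun t ht => ?_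
    rw [norm_mul, hnE, mul_one, Complex.norm_real, Real.norm_eq_abs]
    exact hh'b t ⟨ht.1.le, ht.2⟩
  rw [intervalIntegral.integral_const_mul] at hI2
  have hcB : Continuous fun t =>
      Complex.I * ((h t : ℂ) * (Complex.I * ((ρ * p t : ℝ) : ℂ) * E t)) := by
    fun_prop
  have hcA : Continuous fun t => ((1 / (1 + ρ * p t ^ 2) : ℝ) : ℂ) * E t :=
    (Complex.continuous_ofReal.comp hcinv).mul hcE
  have htot : ∫ t in (0 : ℝ)..L, E t =
      (∫ t in (0 : ℝ)..L, ((1 / (1 + ρ * p t ^ 2) : ℝ) : ℂ) * E t) -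
      Complex.I * ∫ t in (0 : ℝ)..L, (h t : ℂ) * (Complex.I * ((ρ * p t : ℝ) : ℂ) * E t) := by
    rw [← intervalIntegral.integral_const_mul, ← intervalIntegral.integral_sub
      (hcA.intervalIntegrable _ _) (hcB.intervalIntegrable _ _)]
    exact intervalIntegral.integral_congr fun t _ => hsplit t
  rw [htot, hparts]
  have hbd : ∀ t, ‖(h t : ℂ) * E t‖ ≤ 1 / (2 * √ρ) := fun t => by
    rw [norm_mul, hnE, mul_one, Complex.norm_real, Real.norm_eq_abs]; exact hhb t
  have hhalf : 1 / (2 * √ρ) + 1 / (2 * √ρ) = 1 / √ρ := by field_simp; norm_num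
  calc _ ≤ ‖∫ t in (0 : ℝ)..L, ((1 / (1 + ρ * p t ^ 2) : ℝ) : ℂ) * E t‖ +
        (‖(h L : ℂ) * E L‖ + ‖(h 0 : ℂ) * E 0‖ + ‖∫ t in (0 : ℝ)..L, (h' t : ℂ) * E t‖) := by
        refine (norm_sub_le _ _).trans ?_
        gcongr
        rw [norm_mul, Complex.norm_I, one_mul]
        refine (norm_sub_le _ _).trans ?_
        gcongr
        exact norm_sub_le _ _
    _ ≤ 1 / √ρ + (1 + K) * ∫ t in (0 : ℝ)..L, 1 / (1 + ρ * p t ^ 2) := by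
        linarith [hbd L, hbd 0]
    _ ≤ _ := by gcongr


theorem exists_three_derivs {f : ℝ → ℝ} (hf : ContDiff ℝ (⊤ : ℕ∞) f) :
    (∀ t, HasDerivAt f (deriv f t) t) ∧ (∀ t, HasDerivAt (deriv f) (deriv (deriv f) t) t) ∧
      (∀ t, HasDerivAt (deriv (deriv f)) (deriv (deriv (deriv f)) t) t) ∧
      Continuous (deriv (deriv (deriv f))) := by
  have h1 : ContDiff ℝ (⊤ : ℕ∞) (deriv f) := (contDiff_infty_iff_deriv.1 hf).2
  have h2 : ContDiff ℝ (⊤ : ℕ∞) (deriv (deriv f)) := (contDiff_infty_iff_deriv.1 h1).2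
  have h3 : ContDiff ℝ (⊤ : ℕ∞) (deriv (deriv (deriv f))) := (contDiff_infty_iff_deriv.1 h2).2
  exact ⟨fun t => ((contDiff_infty_iff_deriv.1 hf).1 t).hasDerivAt,
    fun t => ((contDiff_infty_iff_deriv.1 h1).1 t).hasDerivAt,
    fun t => ((contDiff_infty_iff_deriv.1 h2).1 t).hasDerivAt, h3.continuous⟩

/-- A unit vector, an orthogonal vector of length at least `k`, and a unit covector. -/
theorem one_le_sq_add_of_orthogonal {a b c d u v k : ℝ} (hk : 0 < k) (h1 : a ^ 2 + b ^ 2 = 1)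
    (h2 : a * c + b * d = 0) (h3 : k ^ 2 ≤ c ^ 2 + d ^ 2) (hu : u ^ 2 + v ^ 2 = 1) :
    1 ≤ (u * a + v * b) ^ 2 + 1 / k ^ 2 * (u * c + v * d) ^ 2 := by
  have hk2 : 0 < k ^ 2 := by positivity
  obtain ⟨s, hc, hd⟩ : ∃ s, c = -s * b ∧ d = s * a := by
    refine ⟨a * d - b * c, ?_, ?_⟩
    · linear_combination (-c) * h1 + a * h2
    · linear_combination (-d) * h1 + b * h2
  have hs : k ^ 2 ≤ s ^ 2 := by
    calc k ^ 2 ≤ c ^ 2 + d ^ 2 := h3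
      _ = s ^ 2 * (a ^ 2 + b ^ 2) := by rw [hc, hd]; ring
      _ = s ^ 2 := by rw [h1, mul_one]
  have e : (u * c + v * d) ^ 2 = s ^ 2 * (v * a - u * b) ^ 2 := by rw [hc, hd]; ring
  have e' : (u * a + v * b) ^ 2 + (v * a - u * b) ^ 2 = 1 := by
    calc _ = (u ^ 2 + v ^ 2) * (a ^ 2 + b ^ 2) := by ring
      _ = 1 := by rw [hu, h1, one_mul]
  rw [e]
  have : (v * a - u * b) ^ 2 ≤ 1 / k ^ 2 * (s ^ 2 * (v * a - u * b) ^ 2) := by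
    rw [one_div, le_inv_mul_iff₀ hk2]
    exact mul_le_mul_of_nonneg_right hs (sq_nonneg _)
  linarith

theorem abs_add_le_of_sq_add_sq {u v c d K : ℝ} (hu : u ^ 2 + v ^ 2 = 1)
    (h : √(c ^ 2 + d ^ 2) ≤ K) : |u * c + v * d| ≤ K := by
  refine le_trans (Real.abs_le_sqrt ?_) h
  calc (u * c + v * d) ^ 2 ≤ (u ^ 2 + v ^ 2) * (c ^ 2 + d ^ 2) := by
        nlinarith [sq_nonneg (u * d - v * c)]
    _ = _ := by rw [hu, one_mul]

/-- Decay of the Fourier transform of arc length on a curve with nonvanishing curvature. -/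
theorem exists_curve_decay {L Kmin Kmax : ℝ} {γ : ℝ → ℝ × ℝ}
    (hL : 0 < L) (hKmin : 0 < Kmin)
    (hsmooth : ContDiff ℝ (⊤ : ℕ∞) γ)
    (hunit : ∀ t ∈ Set.Icc (0:ℝ) L, e2 (deriv γ t) = 1)
    (hcurv : ∀ t ∈ Set.Icc (0:ℝ) L,
      Kmin ≤ e2 (deriv (deriv γ) t) ∧ e2 (deriv (deriv γ) t) ≤ Kmax) :
    ∃ C : ℝ, 0 < C ∧ ∀ ξ : ℂ, ‖∫ t in (0:ℝ)..L, Complex.exp (Complex.I *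
      Complex.ofReal (ξ.re * (γ t).1 + ξ.im * (γ t).2))‖ ≤ C / √(1 + ‖ξ‖) := by
  set x : ℝ → ℝ := fun t => (γ t).1 with hx
  set y : ℝ → ℝ := fun t => (γ t).2 with hy
  have hxs : ContDiff ℝ (⊤ : ℕ∞) x := contDiff_fst.comp hsmooth
  have hys : ContDiff ℝ (⊤ : ℕ∞) y := contDiff_snd.comp hsmooth
  obtain ⟨x1, x2, x3, xc⟩ := exists_three_derivs hxs
  obtain ⟨y1, y2, y3, yc⟩ := exists_three_derivs hys
  have hg1 : deriv γ = fun t => (deriv x t, deriv y t) :=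
    funext fun t => ((x1 t).prodMk (y1 t)).deriv
  have hg2 : deriv (deriv γ) = fun t => (deriv (deriv x) t, deriv (deriv y) t) := by
    rw [hg1]
    exact funext fun t => ((x2 t).prodMk (y2 t)).deriv
  have hu1 : ∀ t ∈ Set.Icc (0:ℝ) L, deriv x t ^ 2 + deriv y t ^ 2 = 1 := by
    intro t ht
    have := hunit t ht
    rwa [hg1, e2, Real.sqrt_eq_one] at this
  have horth : ∀ t ∈ Set.Icc (0:ℝ) L,
      deriv x t * deriv (deriv x) t + deriv y t * deriv (deriv y) t = 0 := by
    intro t ht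
    have hd : HasDerivAt (fun s => deriv x s ^ 2 + deriv y s ^ 2)
        (2 * (deriv x t * deriv (deriv x) t + deriv y t * deriv (deriv y) t)) t :=
      (((x2 t).pow 2).add ((y2 t).pow 2)).congr_deriv (by simp; ring)
    have hd1 := hd.hasDerivWithinAt (s := Set.Icc (0:ℝ) L)
    have hd2 : HasDerivWithinAt (fun s => deriv x s ^ 2 + deriv y s ^ 2) 0 (Set.Icc (0:ℝ) L) t :=
      (hasDerivWithinAt_const t (Set.Icc (0:ℝ) L) (1 : ℝ)).congr (fun s hs => hu1 s hs) (hu1 t ht)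
    have := (uniqueDiffOn_Icc hL t ht).eq_deriv _ hd1 hd2
    linarith
  have hk1 : ∀ t ∈ Set.Icc (0:ℝ) L, Kmin ^ 2 ≤ deriv (deriv x) t ^ 2 + deriv (deriv y) t ^ 2 := by
    intro t ht
    have := (hcurv t ht).1
    rw [hg2, e2] at this
    exact (Real.le_sqrt hKmin.le (by positivity)).1 this
  have hk2 : ∀ t ∈ Set.Icc (0:ℝ) L,
      √(deriv (deriv x) t ^ 2 + deriv (deriv y) t ^ 2) ≤ Kmax := by
    intro t ht
    have := (hcurv t ht).2
    rwa [hg2, e2] at this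
  have hc3 : Continuous fun t =>
      √(deriv (deriv (deriv x)) t ^ 2 + deriv (deriv (deriv y)) t ^ 2) := by fun_prop
  obtain ⟨D, hD⟩ := (isCompact_Icc (a := (0:ℝ)) (b := L)).bddAbove_image hc3.continuousOn
  have hD' : ∀ t ∈ Set.Icc (0:ℝ) L,
      √(deriv (deriv (deriv x)) t ^ 2 + deriv (deriv (deriv y)) t ^ 2) ≤ D :=
    fun t ht => hD ⟨t, ht, rfl⟩
  have h0 : (0 : ℝ) ∈ Set.Icc 0 L := ⟨le_rfl, hL.le⟩
  have hD0 : 0 ≤ D := (Real.sqrt_nonneg _).trans (hD' 0 h0)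
  have hK0 : 0 ≤ Kmax := (Real.sqrt_nonneg _).trans (hk2 0 h0)
  set M : ℝ := 1 / Kmin ^ 2 with hM
  have hM0 : 0 ≤ M := by positivity
  set B : ℝ := 1 + (1 + Kmax) * (L + M * (2 * (Kmax + Kmax + L * D))) with hB
  have hB0 : 0 < B := by positivity
  refine ⟨2 * B + 2 * L, by positivity, fun ξ => ?_⟩
  have hs : 0 < √(1 + ‖ξ‖) := Real.sqrt_pos.2 (by positivity)
  rw [le_div_iff₀ hs]
  rcases lt_or_ge ‖ξ‖ 1 with hlt | hge
  · have h1 : ‖∫ t in (0:ℝ)..L, Complex.exp (Complex.I *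
        Complex.ofReal (ξ.re * x t + ξ.im * y t))‖ ≤ 1 * |L - 0| :=
      intervalIntegral.norm_integral_le_of_norm_le_const fun t _ => by
        rw [mul_comm, Complex.norm_exp_ofReal_mul_I]
    rw [sub_zero, abs_of_pos hL, one_mul] at h1
    have h2 : √(1 + ‖ξ‖) ≤ 2 := by
      rw [Real.sqrt_le_left (by norm_num)]; linarith
    calc _ ≤ L * 2 := mul_le_mul h1 h2 hs.le hL.le
      _ ≤ _ := by linarith
  · set ρ : ℝ := ‖ξ‖ with hρ
    have hρ0 : 0 < ρ := by linarith
    have hnorm : ξ.re ^ 2 + ξ.im ^ 2 = ρ ^ 2 := by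
      rw [hρ, Complex.sq_norm, Complex.normSq_apply]; ring
    have huv : (ξ.re / ρ) ^ 2 + (ξ.im / ρ) ^ 2 = 1 := by
      rw [div_pow, div_pow, ← add_div, hnorm, div_self (by positivity)]
    set u := ξ.re / ρ with hu
    set v := ξ.im / ρ with hv
    have main := norm_intervalIntegral_exp_le (L := L) (M := M) (ρ := ρ)
      (q := fun t => u * x t + v * y t) (p := fun t => u * deriv x t + v * deriv y t)
      (p' := fun t => u * deriv (deriv x) t + v * deriv (deriv y) t)
      (p'' := fun t => u * deriv (deriv (deriv x)) t + v * deriv (deriv (deriv y)) t)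
      (K := Kmax) (D := D) hL hρ0 hM0
      (fun t => ((x1 t).const_mul u).add ((y1 t).const_mul v))
      (fun t => ((x2 t).const_mul u).add ((y2 t).const_mul v))
      (fun t => ((x3 t).const_mul u).add ((y3 t).const_mul v))
      (by fun_prop)
      (fun t ht => one_le_sq_add_of_orthogonal hKmin (hu1 t ht) (horth t ht) (hk1 t ht) huv)
      (fun t ht => abs_add_le_of_sq_add_sq huv (hk2 t ht))
      (fun t ht => abs_add_le_of_sq_add_sq huv (hD' t ht))
    have hphase : ∀ t, ρ * (u * x t + v * y t) = ξ.re * x t + ξ.im * y t := by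
      intro t
      rw [hu, hv]
      field_simp
    simp only [hphase] at main
    have hsq : 0 < √ρ := Real.sqrt_pos.2 hρ0
    have h1 : √(1 + ρ) ≤ 2 * √ρ := by
      rw [Real.sqrt_le_left (by positivity), mul_pow, Real.sq_sqrt hρ0.le]; linarith
    have h2 : L / ρ ≤ L / √ρ := by
      gcongr
      rw [Real.sqrt_le_left hρ0.le]; nlinarith
    have h3 : 1 / √ρ + (1 + Kmax) * (L / ρ + M * (2 * (Kmax + Kmax + L * D)) / √ρ) ≤ B / √ρ := by
      calc _ ≤ 1 / √ρ + (1 + Kmax) * (L / √ρ + M * (2 * (Kmax + Kmax + L * D)) / √ρ) := by gcongr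
        _ = _ := by rw [hB]; ring
    calc _ ≤ B / √ρ * (2 * √ρ) :=
          mul_le_mul (main.trans h3) h1 hs.le (by positivity)
      _ = 2 * B := by field_simp
      _ ≤ _ := by linarith


theorem ofReal_normSq_sum_mul_exp {ι : Type*} (s : Finset ι) (b : ι → ℂ) (θ : ι → ℝ) :
    ((‖∑ i ∈ s, b i * Complex.exp (Complex.I * (θ i : ℂ))‖ ^ 2 : ℝ) : ℂ) =
      ∑ i ∈ s, ∑ j ∈ s, b i * starRingEnd ℂ (b j) *
        Complex.exp (Complex.I * ((θ i - θ j : ℝ) : ℂ)) := by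
  rw [← Complex.normSq_eq_norm_sq, ← Complex.mul_conj, map_sum, Finset.sum_mul_sum]
  refine Finset.sum_congr rfl fun i _ => Finset.sum_congr rfl fun j _ => ?_
  rw [map_mul, ← Complex.exp_conj, map_mul, Complex.conj_I, Complex.conj_ofReal]
  have : Complex.exp (Complex.I * ((θ i - θ j : ℝ) : ℂ)) =
      Complex.exp (Complex.I * (θ i : ℂ)) * Complex.exp (-Complex.I * (θ j : ℂ)) := by
    rw [← Complex.exp_add]
    congr 1
    push_cast
    ring
  rw [this]
  ring

theorem intervalIntegral_normSq_sum_mul_exp_le {ι : Type*} (s : Finset ι) (b : ι → ℂ)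
    (θ : ι → ℝ → ℝ) (hθ : ∀ i, Continuous (θ i)) (L : ℝ) :
    ∫ t in (0:ℝ)..L, ‖∑ i ∈ s, b i * Complex.exp (Complex.I * (θ i t : ℂ))‖ ^ 2 ≤
      ∑ i ∈ s, ∑ j ∈ s, ‖b i‖ * ‖b j‖ *
        ‖∫ t in (0:ℝ)..L, Complex.exp (Complex.I * ((θ i t - θ j t : ℝ) : ℂ))‖ := by
  have hc : ∀ i j, Continuous fun t => b i * starRingEnd ℂ (b j) *
      Complex.exp (Complex.I * ((θ i t - θ j t : ℝ) : ℂ)) := by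
    intro i j
    have := hθ i
    have := hθ j
    fun_prop
  have key : ((∫ t in (0:ℝ)..L, ‖∑ i ∈ s, b i * Complex.exp (Complex.I * (θ i t : ℂ))‖ ^ 2 : ℝ) : ℂ)
      = ∑ i ∈ s, ∑ j ∈ s, b i * starRingEnd ℂ (b j) *
        ∫ t in (0:ℝ)..L, Complex.exp (Complex.I * ((θ i t - θ j t : ℝ) : ℂ)) := by
    rw [← intervalIntegral.integral_ofReal]
    simp_rw [ofReal_normSq_sum_mul_exp s b]
    rw [intervalIntegral.integral_finsetSum fun i _ => Continuous.intervalIntegrable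
      (continuous_finsetSum _ fun j _ => hc i j) _ _]
    refine Finset.sum_congr rfl fun i _ => ?_
    rw [intervalIntegral.integral_finsetSum fun j _ => (hc i j).intervalIntegrable _ _]
    refine Finset.sum_congr rfl fun j _ => ?_
    rw [intervalIntegral.integral_const_mul]
  refine (le_abs_self _).trans ?_
  rw [← Real.norm_eq_abs, ← Complex.norm_real, key]
  refine (norm_sum_le _ _).trans (Finset.sum_le_sum fun i _ => ?_)
  refine (norm_sum_le _ _).trans (Finset.sum_le_sum fun j _ => ?_)
  rw [norm_mul, norm_mul, RCLike.norm_conj]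

theorem setIntegral_Icc_exp_int (k : ℤ) :
    ∫ x in Set.Icc (0:ℝ) (2 * π), Complex.exp (Complex.I * ((k * x : ℝ) : ℂ)) =
      if k = 0 then 2 * π else 0 := by
  rw [integral_Icc_eq_integral_Ioc, ← intervalIntegral.integral_of_le (by positivity)]
  split_ifs with h
  · subst h
    simp
  · have hk : Complex.I * k ≠ 0 := mul_ne_zero Complex.I_ne_zero (by exact_mod_cast h)
    have : ∀ x : ℝ, Complex.exp (Complex.I * ((k * x : ℝ) : ℂ)) =
        Complex.exp (Complex.I * k * x) := fun x => by push_cast; ring_nf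
    simp_rw [this]
    rw [integral_exp_mul_complex hk]
    have e : Complex.exp (Complex.I * k * ((2 * π : ℝ) : ℂ)) = 1 := by
      rw [← Complex.exp_int_mul_two_pi_mul_I k]
      congr 1
      push_cast
      ring
    rw [e]
    simp

theorem l2T_efn_sq (lam : ℝ) (a : ℤ × ℤ → ℂ) :
    l2T (efn lam a) ^ 2 = 4 * π ^ 2 * ∑ μ ∈ Elat lam, ‖a μ‖ ^ 2 := by
  rw [l2T, Real.sq_sqrt (integral_nonneg fun _ => by positivity)]
  apply Complex.ofReal_injective
  rw [← integral_complex_ofReal]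
  simp only [efn]
  have h1 : ∀ x : ℝ × ℝ, ((‖∑ μ ∈ Elat lam, a μ * Complex.exp (Complex.I *
      Complex.ofReal ((μ.1 : ℝ) * x.1 + (μ.2 : ℝ) * x.2))‖ ^ 2 : ℝ) : ℂ) =
      ∑ μ ∈ Elat lam, ∑ ν ∈ Elat lam, a μ * starRingEnd ℂ (a ν) *
        (Complex.exp (Complex.I * ((((μ.1 - ν.1 : ℤ) : ℝ) * x.1 : ℝ) : ℂ)) *
        Complex.exp (Complex.I * ((((μ.2 - ν.2 : ℤ) : ℝ) * x.2 : ℝ) : ℂ))) := by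
    intro x
    rw [ofReal_normSq_sum_mul_exp]
    refine Finset.sum_congr rfl fun i _ => Finset.sum_congr rfl fun j _ => ?_
    rw [← Complex.exp_add]
    congr 2
    push_cast
    ring
  have hc : ∀ μ ν : ℤ × ℤ, Continuous fun x : ℝ × ℝ => a μ * starRingEnd ℂ (a ν) *
        (Complex.exp (Complex.I * ((((μ.1 - ν.1 : ℤ) : ℝ) * x.1 : ℝ) : ℂ)) *
        Complex.exp (Complex.I * ((((μ.2 - ν.2 : ℤ) : ℝ) * x.2 : ℝ) : ℂ))) := by
    intro μ ν
    fun_prop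
  have hK : IsCompact (Set.Icc (0:ℝ) (2 * π) ×ˢ Set.Icc (0:ℝ) (2 * π)) :=
    isCompact_Icc.prod isCompact_Icc
  have hi : ∀ μ ν : ℤ × ℤ, IntegrableOn (fun x : ℝ × ℝ => a μ * starRingEnd ℂ (a ν) *
        (Complex.exp (Complex.I * ((((μ.1 - ν.1 : ℤ) : ℝ) * x.1 : ℝ) : ℂ)) *
        Complex.exp (Complex.I * ((((μ.2 - ν.2 : ℤ) : ℝ) * x.2 : ℝ) : ℂ))))
        (Set.Icc (0:ℝ) (2 * π) ×ˢ Set.Icc (0:ℝ) (2 * π)) :=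
    fun μ ν => (hc μ ν).continuousOn.integrableOn_compact hK
  refine (integral_congr_ae (Filter.Eventually.of_forall h1)).trans ?_
  rw [integral_finsetSum _ fun i _ => integrable_finsetSum _ fun j _ => hi i j]
  have h2 : ∀ μ ∈ Elat lam, (∫ x in Set.Icc (0:ℝ) (2 * π) ×ˢ Set.Icc (0:ℝ) (2 * π),
      ∑ ν ∈ Elat lam, a μ * starRingEnd ℂ (a ν) *
        (Complex.exp (Complex.I * ((((μ.1 - ν.1 : ℤ) : ℝ) * x.1 : ℝ) : ℂ)) *
        Complex.exp (Complex.I * ((((μ.2 - ν.2 : ℤ) : ℝ) * x.2 : ℝ) : ℂ)))) =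
      4 * π ^ 2 * ((‖a μ‖ ^ 2 : ℝ) : ℂ) := by
    intro μ hμ
    rw [integral_finsetSum _ fun j _ => hi μ j, Finset.sum_eq_single_of_mem μ hμ]
    · rw [integral_const_mul, Measure.volume_eq_prod,
        setIntegral_prod_mul (fun x : ℝ => Complex.exp (Complex.I * ((((μ.1 - μ.1 : ℤ) : ℝ) * x : ℝ) : ℂ)))
          (fun x : ℝ => Complex.exp (Complex.I * ((((μ.2 - μ.2 : ℤ) : ℝ) * x : ℝ) : ℂ))),
        setIntegral_Icc_exp_int, setIntegral_Icc_exp_int, Complex.mul_conj,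
        Complex.normSq_eq_norm_sq]
      simp
      ring
    · intro ν _ hne
      rw [integral_const_mul, Measure.volume_eq_prod,
        setIntegral_prod_mul (fun x : ℝ => Complex.exp (Complex.I * ((((μ.1 - ν.1 : ℤ) : ℝ) * x : ℝ) : ℂ)))
          (fun x : ℝ => Complex.exp (Complex.I * ((((μ.2 - ν.2 : ℤ) : ℝ) * x : ℝ) : ℂ))),
        setIntegral_Icc_exp_int, setIntegral_Icc_exp_int]
      have : ¬ (μ.1 - ν.1 = 0 ∧ μ.2 - ν.2 = 0) := by
        rintro ⟨h, h'⟩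
        exact hne (Prod.ext (by omega) (by omega))
      by_cases h : μ.1 - ν.1 = 0
      · rw [if_neg (fun h' => this ⟨h, h'⟩)]; simp
      · rw [if_neg h]; simp
  rw [Finset.sum_congr rfl h2, ← Finset.mul_sum]
  push_cast
  ring

/-- The lattice point `μ` as a complex number. -/
def latC (μ : ℤ × ℤ) : ℂ := ⟨μ.1, μ.2⟩

theorem intervalIntegral_efn_pow_four_le (lam L : ℝ) (a : ℤ × ℤ → ℂ) {γ : ℝ → ℝ × ℝ}
    (hγ : Continuous γ) :
    ∫ t in (0:ℝ)..L, ‖efn lam a (γ t)‖ ^ 4 ≤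
      ∑ P ∈ Elat lam ×ˢ Elat lam, ∑ Q ∈ Elat lam ×ˢ Elat lam,
        (‖a P.1‖ * ‖a P.2‖) * (‖a Q.1‖ * ‖a Q.2‖) *
        ‖∫ t in (0:ℝ)..L, Complex.exp (Complex.I * Complex.ofReal
          ((latC P.1 + latC P.2 - (latC Q.1 + latC Q.2)).re * (γ t).1 +
            (latC P.1 + latC P.2 - (latC Q.1 + latC Q.2)).im * (γ t).2))‖ := by
  have h := intervalIntegral_normSq_sum_mul_exp_le (Elat lam ×ˢ Elat lam)
    (fun P => a P.1 * a P.2)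
    (fun P t => (latC P.1 + latC P.2).re * (γ t).1 + (latC P.1 + latC P.2).im * (γ t).2)
    (fun P => by fun_prop) L
  have e : ∀ t, ‖efn lam a (γ t)‖ ^ 4 = ‖∑ P ∈ Elat lam ×ˢ Elat lam, a P.1 * a P.2 *
      Complex.exp (Complex.I * (((latC P.1 + latC P.2).re * (γ t).1 +
        (latC P.1 + latC P.2).im * (γ t).2 : ℝ) : ℂ))‖ ^ 2 := by
    intro t
    have : efn lam a (γ t) * efn lam a (γ t) = ∑ P ∈ Elat lam ×ˢ Elat lam, a P.1 * a P.2 *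
      Complex.exp (Complex.I * (((latC P.1 + latC P.2).re * (γ t).1 +
        (latC P.1 + latC P.2).im * (γ t).2 : ℝ) : ℂ)) := by
      rw [efn, Finset.sum_mul_sum, ← Finset.sum_product']
      refine Finset.sum_congr rfl fun P _ => ?_
      rw [mul_mul_mul_comm, ← Complex.exp_add]
      congr 2
      simp only [latC, Complex.add_re, Complex.add_im]
      push_cast
      ring
    rw [← this, norm_mul]
    ring
  simp_rw [e]
  refine h.trans_eq (Finset.sum_congr rfl fun P _ => Finset.sum_congr rfl fun Q _ => ?_)
  rw [norm_mul, norm_mul]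
  congr 2
  refine intervalIntegral.integral_congr fun t _ => ?_
  simp only [Complex.sub_re, Complex.sub_im]
  congr 3
  ring


/-- The weighted Hilbert-type kernel controlling interactions between shells. -/
def shellKernel (m k : ℕ) : ℝ :=
  √((1 + m) / (1 + k)) *
    (if |(k : ℝ) - m| ≤ 1 then 1 else √(8 / (|(k : ℝ) - m| * (1 + k + m))))

theorem shellKernel_nonneg (m k : ℕ) : 0 ≤ shellKernel m k := by
  unfold shellKernel
  split_ifs <;> positivity

theorem inv_sqrt_add_one_le (x : ℝ) (hx : 0 ≤ x) : 1 / √(1 + x) ≤ 2 * (√(x + 1) - √x) := by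
  have h1 : 0 < √(1 + x) := Real.sqrt_pos.2 (by linarith)
  have h2 : √x ≤ √(1 + x) := Real.sqrt_le_sqrt (by linarith)
  have h3 := Real.sq_sqrt hx
  have h4 := Real.sq_sqrt (by linarith : 0 ≤ 1 + x)
  rw [add_comm x 1, div_le_iff₀ h1]
  nlinarith [Real.sqrt_nonneg x]

theorem inv_sqrt_abs_le {x : ℝ} (hx : 1 ≤ |x|) :
    1 / √|x| ≤ 3 * ((√(x + 1) - √(-(x + 1))) - (√x - √(-x))) := by
  rcases le_total 0 x with h | h
  · rw [abs_of_nonneg h] at hx ⊢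
    rw [Real.sqrt_eq_zero_of_nonpos (by linarith : -(x + 1) ≤ 0),
      Real.sqrt_eq_zero_of_nonpos (by linarith : -x ≤ 0)]
    have h1 : 1 ≤ √x := Real.one_le_sqrt.2 hx
    have h3 := Real.sq_sqrt h
    have h4 := Real.sq_sqrt (by linarith : 0 ≤ x + 1)
    have h5 : √(x + 1) ≤ 2 * √x := by
      rw [Real.sqrt_le_left (by positivity)]; nlinarith
    rw [div_le_iff₀ (by linarith)]
    nlinarith [Real.sqrt_nonneg (x + 1)]
  · rw [abs_of_nonpos h] at hx ⊢
    rw [Real.sqrt_eq_zero_of_nonpos h, Real.sqrt_eq_zero_of_nonpos (by linarith : x + 1 ≤ 0)]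
    have := inv_sqrt_add_one_le (-x - 1) (by linarith)
    rw [show 1 + (-x - 1) = -x by ring, show -x - 1 + 1 = -x by ring,
      show -x - 1 = -(x + 1) by ring] at this
    have h2 : √(-(x + 1)) ≤ √(-x) := Real.sqrt_le_sqrt (by linarith)
    linarith

theorem shellKernel_le_of_le {m k : ℕ} : shellKernel m k ≤
    (if |(k : ℝ) - m| ≤ 1 then 2 else 0) + 4 / √(1 + m) * (2 * (√((k : ℝ) + 1) - √k) +
      3 * ((√((k : ℝ) - m + 1) - √(-((k : ℝ) - m + 1))) -
        (√((k : ℝ) - m) - √(-((k : ℝ) - m))))) := by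
  have hk : (0 : ℝ) ≤ k := k.cast_nonneg
  have hm : (0 : ℝ) ≤ m := m.cast_nonneg
  have hsm : 0 < √(1 + (m : ℝ)) := Real.sqrt_pos.2 (by linarith)
  have e1 := inv_sqrt_add_one_le k hk
  have e0 : 0 < 1 / √(1 + (k : ℝ)) := one_div_pos.2 (Real.sqrt_pos.2 (by linarith))
  unfold shellKernel
  split_ifs with h
  · have h1 : √((1 + (m : ℝ)) / (1 + k)) ≤ 2 := by
      rw [Real.sqrt_le_left (by norm_num), div_le_iff₀ (by linarith)]
      linarith [(abs_le.1 h).1]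
    have h2 : 0 ≤ (√((k : ℝ) - m + 1) - √(-((k : ℝ) - m + 1))) -
        (√((k : ℝ) - m) - √(-((k : ℝ) - m))) := by
      have := Real.sqrt_le_sqrt (by linarith : (k : ℝ) - m ≤ (k : ℝ) - m + 1)
      have := Real.sqrt_le_sqrt (by linarith : -((k : ℝ) - m + 1) ≤ -((k : ℝ) - m))
      linarith
    have h3 : 0 ≤ 4 / √(1 + (m : ℝ)) := by positivity
    nlinarith [mul_nonneg h3 h2, mul_nonneg h3 (e0.le.trans e1)]
  · rw [zero_add]
    set D : ℝ := |(k : ℝ) - m| with hD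
    have hD1 : 1 < D := not_le.1 h
    have e2 := inv_sqrt_abs_le (x := (k : ℝ) - m) hD1.le
    have hDm : (m : ℝ) - k ≤ D := by rw [hD, abs_sub_comm]; exact le_abs_self _
    rw [← Real.sqrt_mul (by positivity)]
    have hpos : 0 < 4 / √(1 + (m : ℝ)) := by positivity
    have main : √((1 + m) / (1 + k) * (8 / (D * (1 + k + m)))) ≤
        4 / √(1 + m) * (1 / √(1 + k) + 1 / √D) := by
      have hle : (1 + (m : ℝ)) / (1 + k) * (8 / (D * (1 + k + m))) ≤ 8 / ((1 + k) * D) := by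
        rw [div_mul_div_comm, div_le_div_iff₀ (by positivity) (by positivity)]
        have : (0 : ℝ) ≤ (1 + k) * D := by positivity
        nlinarith [mul_nonneg this hk]
      refine (Real.sqrt_le_sqrt hle).trans ?_
      rw [Real.sqrt_le_left (by positivity), mul_pow, div_pow, Real.sq_sqrt (by linarith),
        add_sq, div_pow, div_pow, Real.sq_sqrt (by linarith), Real.sq_sqrt (by linarith)]
      have hq : (8 : ℝ) / ((1 + k) * D) ≤ 4 ^ 2 / (1 + m) * (1 ^ 2 / (1 + k) + 1 ^ 2 / D) := by
        rw [div_add_div _ _ (by positivity) (by positivity), div_mul_div_comm,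
          div_le_div_iff₀ (by positivity) (by positivity)]
        have : (0 : ℝ) ≤ (1 + k) * D := by positivity
        nlinarith [mul_nonneg this hk]
      refine hq.trans ?_
      gcongr
      have : 0 ≤ 2 * (1 / √(1 + (k : ℝ))) * (1 / √D) := by positivity
      linarith
    refine main.trans ?_
    gcongr

theorem shellKernel_le_of_ge {m k : ℕ} (h : 2 * m + 1 ≤ k) : shellKernel m k ≤
    (if |(k : ℝ) - m| ≤ 1 then 2 else 0) + 8 * √(1 + m) * (1 / √k - 1 / √((k : ℝ) + 1)) := by
  have hk0 : (2 * m + 1 : ℝ) ≤ k := by exact_mod_cast h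
  have hm : (0 : ℝ) ≤ m := m.cast_nonneg
  have hk : (0 : ℝ) < k := by linarith
  have hsk : 0 < √(k : ℝ) := Real.sqrt_pos.2 hk
  have hsk1 : 0 < √((k : ℝ) + 1) := Real.sqrt_pos.2 (by linarith)
  have hle : √(k : ℝ) ≤ √((k : ℝ) + 1) := Real.sqrt_le_sqrt (by linarith)
  have e3 := Real.sq_sqrt hk.le
  have e4 := Real.sq_sqrt (by linarith : 0 ≤ (k : ℝ) + 1)
  have hdiff : 1 / (2 * √((k : ℝ) + 1) ^ 3) ≤ 1 / √k - 1 / √((k : ℝ) + 1) := by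
    rw [div_sub_div _ _ hsk.ne' hsk1.ne', div_le_div_iff₀ (by positivity) (by positivity)]
    have h1 : (√((k : ℝ) + 1) - √k) * (√((k : ℝ) + 1) + √k) = 1 := by nlinarith
    have h2 : 1 ≤ (√((k : ℝ) + 1) - √k) * (2 * √((k : ℝ) + 1)) := by
      nlinarith [sub_nonneg.2 hle]
    have h3 : √(k : ℝ) * √((k : ℝ) + 1) ≤ √((k : ℝ) + 1) ^ 2 := by nlinarith
    calc 1 * (√(k : ℝ) * √((k : ℝ) + 1)) ≤ √((k : ℝ) + 1) ^ 2 := by linarith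
      _ ≤ ((√((k : ℝ) + 1) - √k) * (2 * √((k : ℝ) + 1))) * √((k : ℝ) + 1) ^ 2 :=
        le_mul_of_one_le_left (by positivity) h2
      _ = _ := by ring
  have hnn : 0 ≤ 8 * √(1 + (m : ℝ)) * (1 / √k - 1 / √((k : ℝ) + 1)) :=
    mul_nonneg (by positivity) (le_trans (by positivity) hdiff)
  unfold shellKernel
  split_ifs with hc
  · have h1 : √((1 + (m : ℝ)) / (1 + k)) ≤ 2 := by
      rw [Real.sqrt_le_left (by norm_num), div_le_iff₀ (by linarith)]
      linarith
    linarith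
  · rw [zero_add]
    have habs : |(k : ℝ) - m| = k - m := abs_of_nonneg (by linarith)
    rw [habs, ← Real.sqrt_mul (by positivity)]
    have hkm : 0 < (k : ℝ) - m := by linarith
    calc √((1 + m) / (1 + k) * (8 / ((k - m) * (1 + k + m))))
        ≤ √(16 * (1 + m) / (1 + k) ^ 3) := by
          apply Real.sqrt_le_sqrt
          rw [div_mul_div_comm, div_le_div_iff₀ (by positivity) (by positivity)]
          have h5 : (1 + (k : ℝ)) ^ 2 ≤ 2 * ((k - m) * (1 + k + m)) := by nlinarith
          have : (0 : ℝ) ≤ 8 * (1 + m) * (1 + k) := by positivity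
          nlinarith [mul_le_mul_of_nonneg_left h5 this]
      _ = 8 * √(1 + m) * (1 / (2 * √((k : ℝ) + 1) ^ 3)) := by
          rw [Real.sqrt_eq_iff_mul_self_eq (by positivity) (by positivity)]
          have e5 := Real.sq_sqrt (by linarith : 0 ≤ 1 + (m : ℝ))
          have e6 : (√((k : ℝ) + 1) ^ 3) ^ 2 = (1 + k) ^ 3 := by
            rw [← pow_mul, mul_comm 3 2, pow_mul, e4, add_comm]
          calc 16 * (1 + (m : ℝ)) / (1 + k) ^ 3
              = 16 * √(1 + (m : ℝ)) ^ 2 / (√((k : ℝ) + 1) ^ 3) ^ 2 := by rw [e5, e6]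
            _ = _ := by ring
      _ ≤ _ := by gcongr

theorem sum_near_le (m n : ℕ) :
    ∑ k ∈ Finset.range n, (if |(k : ℝ) - m| ≤ 1 then (2 : ℝ) else 0) ≤ 6 := by
  rw [← Finset.sum_filter, Finset.sum_const, nsmul_eq_mul]
  have h : ((Finset.range n).filter fun k : ℕ => |(k : ℝ) - m| ≤ 1) ⊆
      Finset.Icc (m - 1) (m + 1) := by
    intro k hk
    have hk := abs_le.1 (Finset.mem_filter.1 hk).2
    have h1 : (k : ℝ) ≤ m + 1 := by linarith
    have h2 : (m : ℝ) ≤ k + 1 := by linarith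
    have h1 : k ≤ m + 1 := by exact_mod_cast h1
    have h2 : m ≤ k + 1 := by exact_mod_cast h2
    rw [Finset.mem_Icc]
    omega
  have h2 := Finset.card_le_card h
  rw [Nat.card_Icc] at h2
  have h3 : (((Finset.range n).filter fun k : ℕ => |(k : ℝ) - m| ≤ 1).card : ℝ) ≤ 3 := by
    exact_mod_cast h2.trans (by omega : m + 1 + 1 - (m - 1) ≤ 3)
  linarith

theorem sum_shellKernel_le (m n : ℕ) : ∑ k ∈ Finset.range n, shellKernel m k ≤ 60 := by
  have hm : (0 : ℝ) ≤ m := m.cast_nonneg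
  have hsm : 0 < √(1 + (m : ℝ)) := Real.sqrt_pos.2 (by linarith)
  have hmono : ∑ k ∈ Finset.range n, shellKernel m k ≤
      ∑ k ∈ Finset.range (2 * m + 1 + n), shellKernel m k :=
    Finset.sum_le_sum_of_subset_of_nonneg (Finset.range_mono (by omega))
      fun k _ _ => shellKernel_nonneg m k
  refine hmono.trans ?_
  rw [Finset.sum_range_add]
  have A : ∑ k ∈ Finset.range (2 * m + 1), shellKernel m k ≤ 6 + 40 := by
    refine (Finset.sum_le_sum fun k _ => shellKernel_le_of_le).trans ?_
    rw [Finset.sum_add_distrib]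
    refine add_le_add (sum_near_le m _) ?_
    rw [← Finset.mul_sum, Finset.sum_add_distrib, ← Finset.mul_sum, ← Finset.mul_sum]
    have t1 := Finset.sum_range_sub (fun k : ℕ => √(k : ℝ)) (2 * m + 1)
    have t2 := Finset.sum_range_sub (fun k : ℕ => √((k : ℝ) - m) - √(-((k : ℝ) - m))) (2 * m + 1)
    simp only [Nat.cast_add, Nat.cast_one, Nat.cast_mul, Nat.cast_ofNat, Nat.cast_zero] at t1 t2
    have t2' : ∀ k : ℕ, (k : ℝ) + 1 - m = k - m + 1 := fun k => by ring
    simp only [t2'] at t2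
    rw [t1, t2]
    have b1 : √(2 * (m : ℝ) + 1) ≤ 2 * √(1 + m) := by
      rw [Real.sqrt_le_left (by positivity), mul_pow, Real.sq_sqrt (by linarith)]; linarith
    have b2 : √(2 * (m : ℝ) + 1 - m) = √(1 + m) := by ring_nf
    have b3 : √(-(0 - (m : ℝ))) ≤ √(1 + m) := Real.sqrt_le_sqrt (by linarith)
    have b4 : √(0 - (m : ℝ)) = 0 := Real.sqrt_eq_zero_of_nonpos (by linarith)
    rw [b2, b4, Real.sqrt_zero]
    calc _ ≤ 4 / √(1 + (m : ℝ)) * (10 * √(1 + m)) := by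
          gcongr
          linarith [Real.sqrt_nonneg (-(2 * (m : ℝ) + 1 - m))]
      _ = 40 := by field_simp; norm_num
  have B : ∑ k ∈ Finset.range n, shellKernel m (2 * m + 1 + k) ≤ 6 + 8 := by
    refine (Finset.sum_le_sum fun k _ => shellKernel_le_of_ge (by omega)).trans ?_
    rw [Finset.sum_add_distrib]
    refine add_le_add ?_ ?_
    · have := sum_near_le m (2 * m + 1 + n)
      rw [Finset.sum_range_add] at this
      refine le_trans ?_ this
      exact le_add_of_nonneg_left (Finset.sum_nonneg fun k _ => by split_ifs <;> norm_num)
    · rw [← Finset.mul_sum]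
      have t := Finset.sum_range_sub' (fun k : ℕ => 1 / √((2 * m + 1 + k : ℕ) : ℝ)) n
      have e : ∀ k : ℕ, ((2 * m + 1 + (k + 1) : ℕ) : ℝ) = ((2 * m + 1 + k : ℕ) : ℝ) + 1 :=
        fun k => by push_cast; ring
      simp only [e] at t
      rw [t]
      have b : √(1 + (m : ℝ)) ≤ √((2 * m + 1 + 0 : ℕ) : ℝ) := by
        apply Real.sqrt_le_sqrt; push_cast; linarith
      have h0 : 0 ≤ 1 / √((2 * m + 1 + n : ℕ) : ℝ) := by positivity
      calc _ ≤ 8 * √(1 + (m : ℝ)) * (1 / √(1 + (m : ℝ))) := by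
            gcongr
            have := one_div_le_one_div_of_le hsm b
            linarith
        _ = 8 := by field_simp
  linarith

theorem latC_injective : Function.Injective latC := by
  rintro ⟨a, b⟩ ⟨c, d⟩ h
  have h1 := congrArg Complex.re h
  have h2 := congrArg Complex.im h
  simp only [latC, Int.cast_inj] at h1 h2
  rw [h1, h2]

theorem latC_neg (μ : ℤ × ℤ) : latC (-μ) = -latC μ := by
  apply Complex.ext <;> simp [latC]

theorem mem_Elat {lam : ℝ} (hlam : 0 ≤ lam) {μ : ℤ × ℤ} : μ ∈ Elat lam ↔ ‖latC μ‖ = lam := by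
  have key : ‖latC μ‖ = lam ↔ (μ.1 : ℝ) ^ 2 + (μ.2 : ℝ) ^ 2 = lam ^ 2 := by
    rw [← sq_eq_sq₀ (norm_nonneg _) hlam, Complex.sq_norm, Complex.normSq_apply]
    simp only [latC, sq]
  rw [key]
  unfold Elat
  rw [Finset.mem_filter]
  refine ⟨fun h => h.2, fun h => ⟨?_, h⟩⟩
  have h1 := abs_le.1 (abs_le_of_sq_le_sq (by nlinarith [sq_nonneg (μ.2 : ℝ)] :
    (μ.1 : ℝ) ^ 2 ≤ lam ^ 2) hlam)
  have h2 := abs_le.1 (abs_le_of_sq_le_sq (by nlinarith [sq_nonneg (μ.1 : ℝ)] :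
    (μ.2 : ℝ) ^ 2 ≤ lam ^ 2) hlam)
  have hc := Int.le_ceil lam
  rw [Finset.mem_Icc, Prod.le_def, Prod.le_def]
  refine ⟨⟨?_, ?_⟩, ⟨?_, ?_⟩⟩
  · have : ((-⌈lam⌉ : ℤ) : ℝ) ≤ μ.1 := by push_cast; linarith [h1.1]
    exact_mod_cast this
  · have : ((-⌈lam⌉ : ℤ) : ℝ) ≤ μ.2 := by push_cast; linarith [h2.1]
    exact_mod_cast this
  · have : (μ.1 : ℝ) ≤ (⌈lam⌉ : ℤ) := by linarith [h1.2]
    exact_mod_cast this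
  · have : (μ.2 : ℝ) ≤ (⌈lam⌉ : ℤ) := by linarith [h2.2]
    exact_mod_cast this

theorem neg_mem_Elat {lam : ℝ} (hlam : 0 ≤ lam) {μ : ℤ × ℤ} (h : μ ∈ Elat lam) :
    -μ ∈ Elat lam := by
  rw [mem_Elat hlam] at h ⊢
  rw [latC_neg, norm_neg, h]

theorem e2_iv_sub (ξ μ : ℤ × ℤ) : e2 (iv ξ - iv μ) = ‖latC ξ - latC μ‖ := by
  rw [e2, Complex.norm_def, Complex.normSq_apply]
  simp [latC, iv, sq]

theorem e2_iv (μ : ℤ × ℤ) : e2 (iv μ) = ‖latC μ‖ := by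
  rw [e2, Complex.norm_def, Complex.normSq_apply]
  simp [latC, iv, sq]

theorem card_filter_le_Bmax {lam : ℝ} (hlam : 0 ≤ lam) {μ : ℤ × ℤ} (h : μ ∈ Elat lam) :
    ((Elat lam).filter fun ξ => ‖latC ξ - latC μ‖ ≤ √lam).card ≤ Bmax lam := by
  unfold Bmax
  apply le_csSup
  · refine ⟨(Elat lam).card, ?_⟩
    rintro n ⟨x, _, rfl⟩
    exact Finset.card_filter_le _ _
  · refine ⟨iv μ, by rw [e2_iv, (mem_Elat hlam).1 h], ?_⟩
    simp only [e2_iv_sub]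

theorem one_le_Bmax {lam : ℝ} (hlam : 0 ≤ lam) {μ : ℤ × ℤ} (h : μ ∈ Elat lam) :
    1 ≤ Bmax lam := by
  refine le_trans ?_ (card_filter_le_Bmax hlam h)
  rw [Nat.one_le_iff_ne_zero, ← Nat.pos_iff_ne_zero, Finset.card_pos]
  exact ⟨μ, by simp [h]⟩

theorem four_mul_sq_mul_det_sq {x₁ x₂ u₁ u₂ v₁ v₂ lam : ℝ} (hx : x₁ ^ 2 + x₂ ^ 2 = lam ^ 2)
    (hu : (x₁ + u₁) ^ 2 + (x₂ + u₂) ^ 2 = lam ^ 2) (hv : (x₁ + v₁) ^ 2 + (x₂ + v₂) ^ 2 = lam ^ 2) :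
    4 * lam ^ 2 * (u₁ * v₂ - u₂ * v₁) ^ 2 =
      (u₁ ^ 2 + u₂ ^ 2) * (v₁ ^ 2 + v₂ ^ 2) * ((u₁ - v₁) ^ 2 + (u₂ - v₂) ^ 2) := by
  have hp : x₁ * u₁ + x₂ * u₂ = -(u₁ ^ 2 + u₂ ^ 2) / 2 := by linarith
  have hq : x₁ * v₁ + x₂ * v₂ = -(v₁ ^ 2 + v₂ ^ 2) / 2 := by linarith
  have : (x₁ ^ 2 + x₂ ^ 2) * (u₁ * v₂ - u₂ * v₁) ^ 2 =
      (x₁ * u₁ + x₂ * u₂) ^ 2 * (v₁ ^ 2 + v₂ ^ 2) -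
        2 * (x₁ * u₁ + x₂ * u₂) * (x₁ * v₁ + x₂ * v₂) * (u₁ * v₁ + u₂ * v₂) +
        (x₁ * v₁ + x₂ * v₂) ^ 2 * (u₁ ^ 2 + u₂ ^ 2) := by ring
  rw [hx, hp, hq] at this
  linear_combination 4 * this

theorem norm_sub_pos_of_ne {x y : ℤ × ℤ} (h : x ≠ y) : 0 < ‖latC x - latC y‖ :=
  norm_pos_iff.2 (sub_ne_zero.2 (latC_injective.ne h))

theorem norm_latC_sub_sq (x y : ℤ × ℤ) :
    ‖latC x - latC y‖ ^ 2 = ((x.1 : ℝ) - y.1) ^ 2 + ((x.2 : ℝ) - y.2) ^ 2 := by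
  rw [Complex.sq_norm, Complex.normSq_apply]
  simp [latC, sq]

theorem sq_add_sq_of_mem_Elat {lam : ℝ} {μ : ℤ × ℤ} (h : μ ∈ Elat lam) :
    (μ.1 : ℝ) ^ 2 + (μ.2 : ℝ) ^ 2 = lam ^ 2 := by
  unfold Elat at h
  exact (Finset.mem_filter.1 h).2

theorem not_three_close {lam R : ℝ} (hR : 4 * R ^ 3 < lam) (hR0 : 0 ≤ R) {x y z : ℤ × ℤ}
    (hx : x ∈ Elat lam) (hy : y ∈ Elat lam) (hz : z ∈ Elat lam) (hxy : x ≠ y) (hxz : x ≠ z)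
    (hyz : y ≠ z) (dxy : ‖latC x - latC y‖ ≤ 2 * R) (dxz : ‖latC x - latC z‖ ≤ 2 * R)
    (dyz : ‖latC y - latC z‖ ≤ 2 * R) : False := by
  have hlam : 0 < lam := lt_of_le_of_lt (by positivity) hR
  have cx := sq_add_sq_of_mem_Elat hx
  have cy := sq_add_sq_of_mem_Elat hy
  have cz := sq_add_sq_of_mem_Elat hz
  have key := four_mul_sq_mul_det_sq (u₁ := y.1 - x.1) (u₂ := y.2 - x.2) (v₁ := z.1 - x.1)
    (v₂ := z.2 - x.2) cx (by simpa using cy) (by simpa using cz)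
  have e1 := norm_latC_sub_sq x y
  have e2 := norm_latC_sub_sq x z
  have e3 := norm_latC_sub_sq y z
  obtain ⟨D, hD⟩ : ∃ D : ℤ, D = (y.1 - x.1) * (z.2 - x.2) - (y.2 - x.2) * (z.1 - x.1) :=
    ⟨_, rfl⟩
  have hD' : (D : ℝ) = (y.1 - x.1) * (z.2 - x.2) - (y.2 - x.2) * (z.1 - x.1) := by
    rw [hD]; push_cast; ring
  have key' : 4 * lam ^ 2 * (D : ℝ) ^ 2 =
      (‖latC x - latC y‖ * ‖latC x - latC z‖ * ‖latC y - latC z‖) ^ 2 := by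
    rw [mul_pow, mul_pow, e1, e2, e3, hD', key]
    ring
  have hpos : 0 < ‖latC x - latC y‖ * ‖latC x - latC z‖ * ‖latC y - latC z‖ :=
    mul_pos (mul_pos (norm_sub_pos_of_ne hxy) (norm_sub_pos_of_ne hxz)) (norm_sub_pos_of_ne hyz)
  have hle : ‖latC x - latC y‖ * ‖latC x - latC z‖ * ‖latC y - latC z‖ ≤
      2 * R * (2 * R) * (2 * R) := by gcongr
  have hD0 : D ≠ 0 := by
    intro h
    have := pow_pos hpos 2
    rw [← key', h] at this
    simp at this
  have hD1 : (1 : ℝ) ≤ (D : ℝ) ^ 2 := by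
    exact_mod_cast (by positivity : 0 < D ^ 2)
  have h1 : (2 * lam) ^ 2 ≤ (2 * R * (2 * R) * (2 * R)) ^ 2 :=
    calc (2 * lam) ^ 2 ≤ (2 * lam) ^ 2 * (D : ℝ) ^ 2 := le_mul_of_one_le_right (by positivity) hD1
      _ = _ := by rw [← key']; ring
      _ ≤ _ := pow_le_pow_left₀ hpos.le hle 2
  have := (sq_le_sq₀ (by positivity) (by positivity)).1 h1
  linarith

theorem card_filter_close_le_two {lam R : ℝ} (hR : 4 * R ^ 3 < lam) (hR0 : 0 ≤ R) (w : ℂ) :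
    ((Elat lam).filter fun ξ => ‖latC ξ - w‖ ≤ R).card ≤ 2 := by
  by_contra! h
  obtain ⟨x, hx, y, hy, z, hz, hxy, hxz, hyz⟩ := Finset.two_lt_card.1 h
  rw [Finset.mem_filter] at hx hy hz
  have d : ∀ x y : ℤ × ℤ, ‖latC x - w‖ ≤ R → ‖latC y - w‖ ≤ R → ‖latC x - latC y‖ ≤ 2 * R := by
    intro x y hx hy
    have := norm_sub_le (latC x - w) (latC y - w)
    rw [sub_sub_sub_cancel_right] at this
    linarith
  exact not_three_close hR hR0 hx.1 hy.1 hz.1 hxy hxz hyz (d x y hx.2 hy.2) (d x z hx.2 hz.2)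
    (d y z hy.2 hz.2)

theorem card_le_of_fst_snd_close {lam R : ℝ} (hR : 4 * R ^ 3 < lam) (hR0 : 0 ≤ R)
    (h2R : 2 * R ≤ √lam) {s : ℂ} {S : Finset ((ℤ × ℤ) × (ℤ × ℤ))}
    (hS : S ⊆ Elat lam ×ˢ Elat lam)
    (hs : ∀ Q ∈ S, ‖s - (latC Q.1 + latC Q.2)‖ ≤ R)
    (hd : ∀ Q ∈ S, ∀ Q' ∈ S,
      ‖(latC Q.1 - latC Q.2) - (latC Q'.1 - latC Q'.2)‖ ≤ √lam / 2) :
    S.card ≤ 2 * Bmax lam := by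
  have hlam : 0 ≤ lam := le_trans (by positivity) hR.le
  refine (Finset.card_le_mul_card_image (f := Prod.fst) S 2 ?_).trans ?_
  · intro b _
    refine le_trans ?_ (card_filter_close_le_two hR hR0 (s - latC b))
    refine Finset.card_le_card_of_injOn Prod.snd ?_ ?_
    · intro Q hQ
      have hQ := Finset.mem_filter.1 hQ
      refine Finset.mem_coe.2 (Finset.mem_filter.2 ⟨(Finset.mem_product.1 (hS hQ.1)).2, ?_⟩)
      have := hs Q hQ.1
      rw [hQ.2, norm_sub_rev] at this
      rwa [show latC Q.2 - (s - latC b) = latC b + latC Q.2 - s by ring]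
    · intro Q hQ Q' hQ' h
      have hQ := Finset.mem_filter.1 hQ
      have hQ' := Finset.mem_filter.1 hQ'
      exact Prod.ext (hQ.2.trans hQ'.2.symm) h
  · gcongr
    rcases S.eq_empty_or_nonempty with rfl | ⟨Q₀, hQ₀⟩
    · simp
    refine le_trans (Finset.card_le_card ?_)
      (card_filter_le_Bmax hlam (Finset.mem_product.1 (hS hQ₀)).1)
    intro ξ hξ
    obtain ⟨Q, hQ, rfl⟩ := Finset.mem_image.1 hξ
    refine Finset.mem_filter.2 ⟨(Finset.mem_product.1 (hS hQ)).1, ?_⟩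
    have h1 := hs Q hQ
    have h2 := hs Q₀ hQ₀
    have h3 := hd Q hQ Q₀ hQ₀
    have h4 : 2 * ‖latC Q.1 - latC Q₀.1‖ ≤ √lam / 2 + (R + R) := by
      calc 2 * ‖latC Q.1 - latC Q₀.1‖ = ‖2 * (latC Q.1 - latC Q₀.1)‖ := by
            rw [norm_mul]; norm_num
        _ = ‖((latC Q.1 - latC Q.2) - (latC Q₀.1 - latC Q₀.2)) +
              ((s - (latC Q₀.1 + latC Q₀.2)) - (s - (latC Q.1 + latC Q.2)))‖ := by
            congr 1; ring
        _ ≤ _ := (norm_add_le _ _).trans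
            (add_le_add h3 ((norm_sub_le _ _).trans (add_le_add h2 h1)))
    linarith [Real.sqrt_nonneg lam]

theorem re_mul_conj_of_norm_eq {x y : ℂ} (h : ‖x‖ = ‖y‖) :
    ((x - y) * (starRingEnd ℂ) (x + y)).re = 0 := by
  have : ‖x‖ ^ 2 = ‖y‖ ^ 2 := by rw [h]
  rw [Complex.sq_norm, Complex.sq_norm, Complex.normSq_apply, Complex.normSq_apply] at this
  simp
  linarith

theorem abs_re_rotated_le {lam R : ℝ} (hlam : 0 < lam) {s x y : ℂ} (hx : ‖x‖ = lam)
    (hy : ‖y‖ = lam) (hs : √lam * R ≤ ‖s‖) (hR : 0 < R) (h : ‖s - (x + y)‖ ≤ R) :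
    |((x - y) * ((starRingEnd ℂ) s / ‖s‖)).re| ≤ 2 * √lam := by
  have hr : 0 < √lam := Real.sqrt_pos.2 hlam
  have hs0 : 0 < ‖s‖ := lt_of_lt_of_le (by positivity) hs
  have e : (x - y) * ((starRingEnd ℂ) s / ‖s‖) =
      (((x - y) * (starRingEnd ℂ) (s - (x + y))) + (x - y) * (starRingEnd ℂ) (x + y)) /
        (‖s‖ : ℝ) := by
    rw [← mul_add, ← map_add, sub_add_cancel, mul_div_assoc]
  rw [e, Complex.div_ofReal_re, Complex.add_re, re_mul_conj_of_norm_eq (hx.trans hy.symm),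
    add_zero, abs_div, abs_of_pos hs0, div_le_iff₀ hs0]
  have h1 : ‖x - y‖ ≤ 2 * lam := (norm_sub_le _ _).trans (by rw [hx, hy]; linarith)
  calc _ ≤ ‖(x - y) * (starRingEnd ℂ) (s - (x + y))‖ := Complex.abs_re_le_norm _
    _ = ‖x - y‖ * ‖s - (x + y)‖ := by rw [norm_mul, Complex.norm_conj]
    _ ≤ 2 * lam * R := by gcongr
    _ = 2 * √lam * (√lam * R) := by
      have := Real.mul_self_sqrt hlam.le
      linear_combination (-2 * R) * this
    _ ≤ _ := by gcongr

theorem norm_sub_le_of_same_cell {r : ℝ} (hr : 0 < r) {z w : ℂ}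
    (h1 : ⌊4 * z.re / r⌋ = ⌊4 * w.re / r⌋) (h2 : ⌊4 * |z.im| / r⌋ = ⌊4 * |w.im| / r⌋)
    (h3 : 0 ≤ z.im ↔ 0 ≤ w.im) : ‖z - w‖ ≤ r / 2 := by
  have a1 := Int.abs_sub_lt_one_of_floor_eq_floor h1
  have a2 := Int.abs_sub_lt_one_of_floor_eq_floor h2
  rw [← sub_div, abs_div, abs_of_pos hr, div_lt_one hr, ← mul_sub, abs_mul] at a1 a2
  have b : |z.im - w.im| = |(|z.im| - |w.im|)| := by
    by_cases h : 0 ≤ z.im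
    · rw [abs_of_nonneg h, abs_of_nonneg (h3.1 h)]
    · have hw := (not_congr h3).1 h
      rw [abs_of_neg (not_le.1 h), abs_of_neg (not_le.1 hw), ← abs_neg]
      congr 1; ring
  have c := Complex.norm_le_abs_re_add_abs_im (z - w)
  rw [Complex.sub_re, Complex.sub_im, b] at c
  norm_num at a1 a2
  linarith

/-- The ordered pairs of lattice points whose sum is within `R` of `s` and whose difference has
length in the `k`-th shell of width `√lam`. -/
def shellPairs (lam R : ℝ) (s : ℂ) (k : ℕ) : Finset ((ℤ × ℤ) × (ℤ × ℤ)) :=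
  (Elat lam ×ˢ Elat lam).filter fun Q =>
    ‖s - (latC Q.1 + latC Q.2)‖ ≤ R ∧ ⌊‖latC Q.1 - latC Q.2‖ / √lam⌋₊ = k

theorem card_shellPairs_le {lam R : ℝ} (hR : 4 * R ^ 3 < lam) (hR0 : 0 < R) (h2R : 2 * R ≤ √lam)
    {s : ℂ} (hs : √lam * R ≤ ‖s‖) (k : ℕ) :
    (shellPairs lam R s k).card ≤ 884 * Bmax lam := by
  have hlam : 0 < lam := lt_of_le_of_lt (by positivity) hR
  have hr : 0 < √lam := Real.sqrt_pos.2 hlam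
  have hs0 : 0 < ‖s‖ := lt_of_lt_of_le (by positivity) hs
  set ω : ℂ := (starRingEnd ℂ) s / ‖s‖ with hω
  have hω1 : ‖ω‖ = 1 := by
    rw [hω, norm_div, Complex.norm_conj, Complex.norm_real, norm_norm, div_self hs0.ne']
  set z : (ℤ × ℤ) × (ℤ × ℤ) → ℂ := fun Q => (latC Q.1 - latC Q.2) * ω with hz
  let cell : (ℤ × ℤ) × (ℤ × ℤ) → ℤ × ℤ × Bool := fun Q =>
    (⌊4 * (z Q).re / √lam⌋, ⌊4 * |(z Q).im| / √lam⌋, decide (0 ≤ (z Q).im))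
  have step := Finset.card_le_mul_card_image (f := cell) (shellPairs lam R s k) (2 * Bmax lam) ?_
  · refine step.trans ?_
    have : (shellPairs lam R s k).image cell ⊆
        Finset.Icc (-8) 8 ×ˢ Finset.Icc (4 * (k : ℤ) - 8) (4 * k + 4) ×ˢ Finset.univ := by
      intro c hc
      obtain ⟨Q, hQ, rfl⟩ := Finset.mem_image.1 hc
      obtain ⟨hQE, hQR, hQk⟩ := Finset.mem_filter.1 hQ
      obtain ⟨h1, h2⟩ := Finset.mem_product.1 hQE
      have hre := abs_re_rotated_le hlam ((mem_Elat hlam.le).1 h1) ((mem_Elat hlam.le).1 h2) hs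
        hR0 hQR
      have hnorm : ‖z Q‖ = ‖latC Q.1 - latC Q.2‖ := by rw [hz]; simp [hω1]
      have hk := (Nat.floor_eq_iff (by positivity)).1 hQk
      rw [le_div_iff₀ hr, div_lt_iff₀ hr, ← hnorm] at hk
      have c := Complex.norm_le_abs_re_add_abs_im (z Q)
      have c' := Complex.abs_im_le_norm (z Q)
      change |(z Q).re| ≤ _ at hre
      have hre' := abs_le.1 hre
      refine Finset.mem_product.2 ⟨Finset.mem_Icc.2 ⟨?_, ?_⟩, Finset.mem_product.2
        ⟨Finset.mem_Icc.2 ⟨?_, ?_⟩, Finset.mem_univ _⟩⟩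
      · rw [Int.le_floor, le_div_iff₀ hr]; push_cast; linarith
      · rw [← Int.lt_add_one_iff, Int.floor_lt, div_lt_iff₀ hr]; push_cast; linarith
      · rw [Int.le_floor, le_div_iff₀ hr]; push_cast; linarith
      · rw [← Int.lt_add_one_iff, Int.floor_lt, div_lt_iff₀ hr]; push_cast; linarith
    have hc := Finset.card_le_card this
    rw [Finset.card_product, Finset.card_product, Int.card_Icc, Int.card_Icc, Finset.card_univ,
      Fintype.card_bool, show (4 * (k : ℤ) + 4 + 1 - (4 * k - 8)) = 13 by ring] at hc
    calc _ ≤ 2 * Bmax lam * 442 := Nat.mul_le_mul_left _ (hc.trans (by decide))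
      _ = _ := by ring
  · intro c _
    refine card_le_of_fst_snd_close hR hR0.le h2R (s := s) ?_ ?_ ?_
    · exact (Finset.filter_subset _ _).trans (Finset.filter_subset _ _)
    · intro Q hQ
      exact (Finset.mem_filter.1 (Finset.mem_filter.1 hQ).1).2.1
    · intro Q hQ Q' hQ'
      have e := (Finset.mem_filter.1 hQ).2.trans (Finset.mem_filter.1 hQ').2.symm
      simp only [cell, Prod.mk.injEq, decide_eq_decide] at e
      have := norm_sub_le_of_same_cell hr e.1 e.2.1 e.2.2
      rwa [hz, ← sub_mul, norm_mul, hω1, mul_one] at this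

theorem sqrt_mul_inv_sqrt_le_shellKernel {p q r η : ℝ} (hr : 0 < r) (hp : 0 ≤ p) (hq : 0 ≤ q)
    (hη : 0 ≤ η) (h : |p ^ 2 - q ^ 2| ≤ 4 * r ^ 2 * η) :
    √((1 + (⌊p / r⌋₊ : ℝ)) / (1 + ⌊q / r⌋₊)) * (1 / √(1 + η)) ≤
      shellKernel ⌊p / r⌋₊ ⌊q / r⌋₊ := by
  have key : ∀ x y : ℝ, 0 ≤ x → 0 ≤ y → y ^ 2 - x ^ 2 ≤ 4 * r ^ 2 * η →
      (⌊x / r⌋₊ : ℝ) + 1 < ⌊y / r⌋₊ →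
      ((⌊y / r⌋₊ : ℝ) - ⌊x / r⌋₊) * (1 + ⌊y / r⌋₊ + ⌊x / r⌋₊) ≤ 8 * η := by
    intro x y hx hy hxy hlt
    have h1 := Nat.floor_le (div_nonneg hy hr.le)
    have h2 := Nat.lt_floor_add_one (x / r)
    have hlt' : ⌊x / r⌋₊ + 2 ≤ ⌊y / r⌋₊ := by
      have : ⌊x / r⌋₊ + 1 < ⌊y / r⌋₊ := by exact_mod_cast hlt
      omega
    have hge : (⌊x / r⌋₊ : ℝ) + 2 ≤ ⌊y / r⌋₊ := by exact_mod_cast hlt'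
    set j : ℝ := (⌊x / r⌋₊ : ℝ)
    set k : ℝ := (⌊y / r⌋₊ : ℝ)
    have hj : 0 ≤ j := Nat.cast_nonneg _
    have h3 : (y / r) ^ 2 - (x / r) ^ 2 ≤ 4 * η := by
      rw [div_pow, div_pow, ← sub_div, div_le_iff₀ (by positivity)]
      linarith
    have h4 : k ^ 2 ≤ (y / r) ^ 2 := pow_le_pow_left₀ (by linarith) h1 2
    have h5 : (x / r) ^ 2 ≤ (j + 1) ^ 2 := pow_le_pow_left₀ (div_nonneg hx hr.le) h2.le 2
    nlinarith
  unfold shellKernel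
  gcongr
  split_ifs with hc
  · rw [div_le_one (Real.sqrt_pos.2 (by linarith))]
    exact Real.one_le_sqrt.2 (by linarith)
  · have hc := not_le.1 hc
    have hb : |(⌊q / r⌋₊ : ℝ) - ⌊p / r⌋₊| * (1 + ⌊q / r⌋₊ + ⌊p / r⌋₊) ≤ 8 * η := by
      rcases lt_abs.1 hc with h' | h'
      · rw [abs_of_pos (by linarith)]
        exact key p q hp hq (by linarith [(abs_le.1 h).1]) (by linarith)
      · rw [abs_of_neg (by linarith)]
        have := key q p hq hp (by linarith [(abs_le.1 h).2]) (by linarith)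
        linarith
    rw [← Real.sqrt_one, ← Real.sqrt_div zero_le_one, Real.sqrt_one]
    apply Real.sqrt_le_sqrt
    have hpos : 0 < |(⌊q / r⌋₊ : ℝ) - ⌊p / r⌋₊| * (1 + ⌊q / r⌋₊ + ⌊p / r⌋₊) := by positivity
    rw [div_le_div_iff₀ (by linarith) hpos]
    linarith

theorem abs_norm_sub_sq_sub_le {lam : ℝ} {x y z w : ℂ} (hx : ‖x‖ = lam) (hy : ‖y‖ = lam)
    (hz : ‖z‖ = lam) (hw : ‖w‖ = lam) :
    |‖x - y‖ ^ 2 - ‖z - w‖ ^ 2| ≤ 4 * lam * ‖(x + y) - (z + w)‖ := by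
  have h1 := parallelogram_law_with_norm ℝ x y
  have h2 := parallelogram_law_with_norm ℝ z w
  rw [hx, hy] at h1
  rw [hz, hw] at h2
  have e : ‖x - y‖ ^ 2 - ‖z - w‖ ^ 2 = -((‖x + y‖ - ‖z + w‖) * (‖x + y‖ + ‖z + w‖)) := by
    linarith
  have h3 : ‖x + y‖ ≤ 2 * lam := (norm_add_le _ _).trans (by rw [hx, hy]; linarith)
  have h4 : ‖z + w‖ ≤ 2 * lam := (norm_add_le _ _).trans (by rw [hz, hw]; linarith)
  rw [e, abs_neg, abs_mul, abs_of_nonneg (by positivity : 0 ≤ ‖x + y‖ + ‖z + w‖), mul_comm]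
  exact mul_le_mul (by linarith) (abs_norm_sub_norm_le _ _) (abs_nonneg _)
    (by linarith [norm_nonneg (x + y)])

def pairSum (P : (ℤ × ℤ) × (ℤ × ℤ)) : ℂ := latC P.1 + latC P.2

def pairShell (lam : ℝ) (P : (ℤ × ℤ) × (ℤ × ℤ)) : ℕ := ⌊‖latC P.1 - latC P.2‖ / √lam⌋₊

def shellRatio (lam : ℝ) (P Q : (ℤ × ℤ) × (ℤ × ℤ)) : ℝ :=
  √((1 + (pairShell lam P : ℝ)) / (1 + pairShell lam Q))

def decayWeight (z : ℂ) : ℝ := 1 / √(1 + ‖z‖)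

theorem decayWeight_nonneg (z : ℂ) : 0 ≤ decayWeight z := by
  unfold decayWeight
  positivity

theorem decayWeight_sub_comm (z w : ℂ) : decayWeight (z - w) = decayWeight (w - z) := by
  rw [decayWeight, norm_sub_rev, decayWeight]

theorem sum_shellRatio_mul_decayWeight_le {lam R : ℝ} (hR : 4 * R ^ 3 < lam) (hR0 : 0 < R)
    (h2R : 2 * R ≤ √lam) {P : (ℤ × ℤ) × (ℤ × ℤ)} (hP : P ∈ Elat lam ×ˢ Elat lam)
    (hs : √lam * R ≤ ‖pairSum P‖) :
    ∑ Q ∈ (Elat lam ×ˢ Elat lam).filter (fun Q => ‖pairSum P - pairSum Q‖ ≤ R),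
      shellRatio lam P Q * decayWeight (pairSum P - pairSum Q) ≤ 53040 * Bmax lam := by
  have hlam : 0 < lam := lt_of_le_of_lt (by positivity) hR
  have hr : 0 < √lam := Real.sqrt_pos.2 hlam
  set F := (Elat lam ×ˢ Elat lam).filter (fun Q => ‖pairSum P - pairSum Q‖ ≤ R) with hF
  have hterm : ∀ Q ∈ F, shellRatio lam P Q * decayWeight (pairSum P - pairSum Q) ≤
      shellKernel (pairShell lam P) (pairShell lam Q) := by
    intro Q hQ
    have hQ := (Finset.mem_filter.1 hQ).1
    obtain ⟨h1, h2⟩ := Finset.mem_product.1 hP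
    obtain ⟨h3, h4⟩ := Finset.mem_product.1 hQ
    rw [mem_Elat hlam.le] at h1 h2 h3 h4
    have := abs_norm_sub_sq_sub_le h1 h2 h3 h4
    refine sqrt_mul_inv_sqrt_le_shellKernel hr (norm_nonneg _) (norm_nonneg _) (norm_nonneg _) ?_
    rw [Real.sq_sqrt hlam.le]
    exact this
  refine (Finset.sum_le_sum hterm).trans ?_
  have hmaps : ∀ Q ∈ F, pairShell lam Q ∈ Finset.range ((F.sup (pairShell lam)) + 1) :=
    fun Q hQ => Finset.mem_range.2 (Nat.lt_succ_of_le (Finset.le_sup hQ))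
  rw [← Finset.sum_fiberwise_of_maps_to hmaps]
  calc _ ≤ ∑ k ∈ Finset.range ((F.sup (pairShell lam)) + 1),
        (884 * Bmax lam : ℕ) * shellKernel (pairShell lam P) k := by
        refine Finset.sum_le_sum fun k _ => ?_
        rw [Finset.sum_congr rfl fun Q hQ => by rw [(Finset.mem_filter.1 hQ).2],
          Finset.sum_const, nsmul_eq_mul]
        refine mul_le_mul_of_nonneg_right ?_ (shellKernel_nonneg _ _)
        rw [Nat.cast_le]
        refine le_trans (Finset.card_le_card ?_) (card_shellPairs_le hR hR0 h2R hs k)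
        intro Q hQ
        obtain ⟨hQF, hQk⟩ := Finset.mem_filter.1 hQ
        obtain ⟨hQE, hQR⟩ := Finset.mem_filter.1 hQF
        exact Finset.mem_filter.2 ⟨hQE, hQR, hQk⟩
    _ ≤ (884 * Bmax lam : ℕ) * 60 := by
        rw [← Finset.mul_sum]
        exact mul_le_mul_of_nonneg_left (sum_shellKernel_le _ _) (Nat.cast_nonneg _)
    _ = _ := by push_cast; ring

/-- The quadruples for which both pair sums are large while their difference is small. -/
def nearPairs (lam R : ℝ) (P Q : (ℤ × ℤ) × (ℤ × ℤ)) : Prop :=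
  √lam * R ≤ ‖pairSum P‖ ∧ √lam * R ≤ ‖pairSum Q‖ ∧ ‖pairSum P - pairSum Q‖ ≤ R

theorem nearPairs_comm {lam R : ℝ} {P Q : (ℤ × ℤ) × (ℤ × ℤ)} :
    nearPairs lam R P Q ↔ nearPairs lam R Q P := by
  unfold nearPairs
  rw [norm_sub_rev]
  tauto

open Classical in
theorem sum_nearPairs_le {lam R : ℝ} (hR : 4 * R ^ 3 < lam) (hR0 : 0 < R)
    (h2R : 2 * R ≤ √lam) (A : ℤ × ℤ → ℝ) :
    ∑ P ∈ Elat lam ×ˢ Elat lam, ∑ Q ∈ Elat lam ×ˢ Elat lam,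
      (if nearPairs lam R P Q then
        (A P.1 * A P.2) * (A Q.1 * A Q.2) * decayWeight (pairSum P - pairSum Q) else 0) ≤
      53040 * Bmax lam * (∑ μ ∈ Elat lam, A μ ^ 2) ^ 2 := by
  set E := Elat lam ×ˢ Elat lam with hE
  set f : (ℤ × ℤ) × (ℤ × ℤ) → (ℤ × ℤ) × (ℤ × ℤ) → ℝ := fun P Q =>
    if nearPairs lam R P Q then
      (A P.1 * A P.2) ^ 2 * (shellRatio lam P Q * decayWeight (pairSum P - pairSum Q)) else 0
    with hf
  have hterm : ∀ P Q, (if nearPairs lam R P Q then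
        (A P.1 * A P.2) * (A Q.1 * A Q.2) * decayWeight (pairSum P - pairSum Q) else 0) ≤
      (f P Q + f Q P) / 2 := by
    intro P Q
    rw [hf]
    by_cases h : nearPairs lam R P Q
    · simp only [if_pos h, if_pos (nearPairs_comm.1 h)]
      rw [decayWeight_sub_comm (pairSum Q)]
      have hw := decayWeight_nonneg (pairSum P - pairSum Q)
      have hρ : 0 < shellRatio lam P Q := by unfold shellRatio; positivity
      have hinv : shellRatio lam P Q * shellRatio lam Q P = 1 := by
        unfold shellRatio
        rw [← Real.sqrt_mul (by positivity), Real.sqrt_eq_one]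
        field_simp
      have hρ' : 0 < shellRatio lam Q P := by unfold shellRatio; positivity
      have hs1 := Real.sq_sqrt hρ.le
      have hs2 := Real.sq_sqrt hρ'.le
      have hs3 : √(shellRatio lam P Q) * √(shellRatio lam Q P) = 1 := by
        rw [← Real.sqrt_mul hρ.le, hinv, Real.sqrt_one]
      have am : (A P.1 * A P.2) * (A Q.1 * A Q.2) ≤ ((A P.1 * A P.2) ^ 2 * shellRatio lam P Q +
          (A Q.1 * A Q.2) ^ 2 * shellRatio lam Q P) / 2 := by
        have := sq_nonneg ((A P.1 * A P.2) * √(shellRatio lam P Q) -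
          (A Q.1 * A Q.2) * √(shellRatio lam Q P))
        rw [sub_sq, mul_pow _ (√_), mul_pow _ (√_), hs1, hs2] at this
        have e : 2 * ((A P.1 * A P.2) * √(shellRatio lam P Q)) *
          ((A Q.1 * A Q.2) * √(shellRatio lam Q P)) = 2 * ((A P.1 * A P.2) * (A Q.1 * A Q.2)) := by
          linear_combination 2 * ((A P.1 * A P.2) * (A Q.1 * A Q.2)) * hs3
        linarith
      calc _ ≤ _ := mul_le_mul_of_nonneg_right am hw
        _ = _ := by ring
    · have h' : ¬ nearPairs lam R Q P := fun h' => h (nearPairs_comm.1 h')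
      simp only [if_neg h, if_neg h']
      norm_num
  have hrow : ∀ P ∈ E, ∑ Q ∈ E, f P Q ≤ (A P.1 * A P.2) ^ 2 * (53040 * Bmax lam) := by
    intro P hP
    have hB : (0 : ℝ) ≤ 53040 * Bmax lam := by positivity
    by_cases hs : √lam * R ≤ ‖pairSum P‖
    · have := sum_shellRatio_mul_decayWeight_le hR hR0 h2R hP hs
      refine le_trans ?_ (mul_le_mul_of_nonneg_left this (sq_nonneg _))
      rw [Finset.mul_sum, Finset.sum_filter]
      refine Finset.sum_le_sum fun Q _ => ?_
      rw [hf]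
      have hnn : 0 ≤ (A P.1 * A P.2) ^ 2 *
          (shellRatio lam P Q * decayWeight (pairSum P - pairSum Q)) :=
        mul_nonneg (sq_nonneg _) (mul_nonneg (Real.sqrt_nonneg _) (decayWeight_nonneg _))
      by_cases h : nearPairs lam R P Q
      · simp only [if_pos h, if_pos h.2.2]
        exact le_rfl
      · simp only [if_neg h]
        split_ifs
        · exact hnn
        · exact le_rfl
    · rw [Finset.sum_eq_zero]
      · positivity
      · intro Q _
        rw [hf]
        exact if_neg fun h => hs h.1
  have htot : ∑ P ∈ E, ∑ Q ∈ E, f P Q ≤ 53040 * Bmax lam * (∑ μ ∈ Elat lam, A μ ^ 2) ^ 2 := by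
    refine (Finset.sum_le_sum hrow).trans (le_of_eq ?_)
    rw [← Finset.sum_mul, mul_comm]
    congr 1
    rw [hE, Finset.sum_product, sq, Finset.sum_mul_sum]
    simp only [mul_pow]
  calc _ ≤ ∑ P ∈ E, ∑ Q ∈ E, (f P Q + f Q P) / 2 :=
        Finset.sum_le_sum fun P _ => Finset.sum_le_sum fun Q _ => hterm P Q
    _ = (∑ P ∈ E, ∑ Q ∈ E, f P Q + ∑ P ∈ E, ∑ Q ∈ E, f Q P) / 2 := by
        simp only [← Finset.sum_div, Finset.sum_add_distrib]
    _ ≤ _ := by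
        rw [Finset.sum_comm (f := fun P Q => f Q P)]
        linarith

theorem pairSum_cover {lam R : ℝ} (hlam : 0 ≤ lam) (hT : 3 * (√lam * R) + 4 * R < 2 * lam)
    {x y z w : ℤ × ℤ} (hx : x ∈ Elat lam)
    (h : ‖pairSum (x, y) - pairSum (z, w)‖ ≤ R) :
    nearPairs lam R (x, y) (z, w) ∨ nearPairs lam R (x, -z) (-y, w) ∨
      nearPairs lam R (x, -w) (z, -y) := by
  have hx := (mem_Elat hlam).1 hx
  have aux : ∀ P Q : (ℤ × ℤ) × (ℤ × ℤ), ‖pairSum P - pairSum Q‖ ≤ R → ¬ nearPairs lam R P Q →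
      ‖pairSum P‖ ≤ √lam * R + R := by
    intro P Q hPQ hn
    by_contra! hlt
    have h2 := norm_sub_norm_le (pairSum P) (pairSum Q)
    have h3 := (norm_nonneg _).trans hPQ
    exact hn ⟨by linarith, by linarith, hPQ⟩
  by_contra! hn
  obtain ⟨h1, h2, h3⟩ := hn
  have e2 : pairSum (x, -z) - pairSum (-y, w) = pairSum (x, y) - pairSum (z, w) := by
    simp only [pairSum, latC_neg]; ring
  have e3 : pairSum (x, -w) - pairSum (z, -y) = pairSum (x, y) - pairSum (z, w) := by
    simp only [pairSum, latC_neg]; ring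
  have a1 := aux _ _ h h1
  have a2 := aux _ _ (e2 ▸ h) h2
  have a3 := aux _ _ (e3 ▸ h) h3
  have e : 2 * latC x = pairSum (x, y) + pairSum (x, -z) + pairSum (x, -w) -
      (pairSum (x, y) - pairSum (z, w)) := by
    simp only [pairSum, latC_neg]; ring
  have := norm_sub_le (pairSum (x, y) + pairSum (x, -z) + pairSum (x, -w))
    (pairSum (x, y) - pairSum (z, w))
  rw [← e, norm_mul, hx] at this
  have t := norm_add₃_le (a := pairSum (x, y)) (b := pairSum (x, -z)) (c := pairSum (x, -w))
  norm_num at this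
  linarith

theorem sum_product_swap_neg_left {lam : ℝ} (hlam : 0 ≤ lam)
    (f : (ℤ × ℤ) × (ℤ × ℤ) → (ℤ × ℤ) × (ℤ × ℤ) → ℝ) :
    ∑ P ∈ Elat lam ×ˢ Elat lam, ∑ Q ∈ Elat lam ×ˢ Elat lam, f (P.1, -Q.1) (-P.2, Q.2) =
      ∑ P ∈ Elat lam ×ˢ Elat lam, ∑ Q ∈ Elat lam ×ˢ Elat lam, f P Q := by
  rw [← Finset.sum_product', ← Finset.sum_product']
  refine Finset.sum_nbij' (fun p => ((p.1.1, -p.2.1), (-p.1.2, p.2.2)))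
    (fun p => ((p.1.1, -p.2.1), (-p.1.2, p.2.2))) ?_ ?_ ?_ ?_ ?_
  · rintro ⟨⟨x, y⟩, ⟨z, w⟩⟩ h
    simp only [Finset.mem_product] at h ⊢
    exact ⟨⟨h.1.1, neg_mem_Elat hlam h.2.1⟩, ⟨neg_mem_Elat hlam h.1.2, h.2.2⟩⟩
  · rintro ⟨⟨x, y⟩, ⟨z, w⟩⟩ h
    simp only [Finset.mem_product] at h ⊢
    exact ⟨⟨h.1.1, neg_mem_Elat hlam h.2.1⟩, ⟨neg_mem_Elat hlam h.1.2, h.2.2⟩⟩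
  · rintro ⟨⟨x, y⟩, ⟨z, w⟩⟩ _
    simp only [neg_neg]
  · rintro ⟨⟨x, y⟩, ⟨z, w⟩⟩ _
    simp only [neg_neg]
  · rintro ⟨⟨x, y⟩, ⟨z, w⟩⟩ _
    rfl

theorem sum_product_swap_neg_right {lam : ℝ} (hlam : 0 ≤ lam)
    (f : (ℤ × ℤ) × (ℤ × ℤ) → (ℤ × ℤ) × (ℤ × ℤ) → ℝ) :
    ∑ P ∈ Elat lam ×ˢ Elat lam, ∑ Q ∈ Elat lam ×ˢ Elat lam, f (P.1, -Q.2) (Q.1, -P.2) =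
      ∑ P ∈ Elat lam ×ˢ Elat lam, ∑ Q ∈ Elat lam ×ˢ Elat lam, f P Q := by
  rw [← Finset.sum_product', ← Finset.sum_product']
  refine Finset.sum_nbij' (fun p => ((p.1.1, -p.2.2), (p.2.1, -p.1.2)))
    (fun p => ((p.1.1, -p.2.2), (p.2.1, -p.1.2))) ?_ ?_ ?_ ?_ ?_
  · rintro ⟨⟨x, y⟩, ⟨z, w⟩⟩ h
    simp only [Finset.mem_product] at h ⊢
    exact ⟨⟨h.1.1, neg_mem_Elat hlam h.2.2⟩, ⟨h.2.1, neg_mem_Elat hlam h.1.2⟩⟩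
  · rintro ⟨⟨x, y⟩, ⟨z, w⟩⟩ h
    simp only [Finset.mem_product] at h ⊢
    exact ⟨⟨h.1.1, neg_mem_Elat hlam h.2.2⟩, ⟨h.2.1, neg_mem_Elat hlam h.1.2⟩⟩
  · rintro ⟨⟨x, y⟩, ⟨z, w⟩⟩ _
    simp only [neg_neg]
  · rintro ⟨⟨x, y⟩, ⟨z, w⟩⟩ _
    simp only [neg_neg]
  · rintro ⟨⟨x, y⟩, ⟨z, w⟩⟩ _
    rfl

theorem sum_product_mul_le (E : Finset (ℤ × ℤ)) (A : ℤ × ℤ → ℝ) :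
    ∑ P ∈ E ×ˢ E, ∑ Q ∈ E ×ˢ E, (A P.1 * A P.2) * (A Q.1 * A Q.2) ≤
      (E.card : ℝ) ^ 2 * (∑ μ ∈ E, A μ ^ 2) ^ 2 := by
  have h : ∑ P ∈ E ×ˢ E, A P.1 * A P.2 = (∑ μ ∈ E, A μ) ^ 2 := by
    rw [Finset.sum_product, sq, Finset.sum_mul_sum]
  rw [← Finset.sum_mul_sum, h, ← sq, ← mul_pow]
  exact pow_le_pow_left₀ (sq_nonneg _) sq_sum_le_card_mul_sum_sq 2

open Classical in
theorem sum_decayWeight_le {lam R : ℝ} (hR : 4 * R ^ 3 < lam) (hR0 : 0 < R)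
    (h2R : 2 * R ≤ √lam) (hT : 3 * (√lam * R) + 4 * R < 2 * lam) {A : ℤ × ℤ → ℝ}
    (hA : ∀ μ, 0 ≤ A μ) (hAneg : ∀ μ, A (-μ) = A μ) :
    ∑ P ∈ Elat lam ×ˢ Elat lam, ∑ Q ∈ Elat lam ×ˢ Elat lam,
      (A P.1 * A P.2) * (A Q.1 * A Q.2) * decayWeight (pairSum P - pairSum Q) ≤
      (159120 * Bmax lam + (Elat lam).card ^ 2 / √R) * (∑ μ ∈ Elat lam, A μ ^ 2) ^ 2 := by
  have hlam : 0 < lam := lt_of_le_of_lt (by positivity) hR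
  set h : (ℤ × ℤ) × (ℤ × ℤ) → (ℤ × ℤ) × (ℤ × ℤ) → ℝ := fun P Q =>
    if nearPairs lam R P Q then
      (A P.1 * A P.2) * (A Q.1 * A Q.2) * decayWeight (pairSum P - pairSum Q) else 0 with hh
  have hnn : ∀ P Q : (ℤ × ℤ) × (ℤ × ℤ), 0 ≤ (A P.1 * A P.2) * (A Q.1 * A Q.2) := fun P Q =>
    mul_nonneg (mul_nonneg (hA _) (hA _)) (mul_nonneg (hA _) (hA _))
  have hnonneg : ∀ P Q, 0 ≤ h P Q := by
    intro P Q
    rw [hh]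
    dsimp only
    split_ifs
    · exact mul_nonneg (hnn P Q) (decayWeight_nonneg _)
    · exact le_rfl
  have hterm : ∀ P ∈ Elat lam ×ˢ Elat lam, ∀ Q ∈ Elat lam ×ˢ Elat lam,
      (A P.1 * A P.2) * (A Q.1 * A Q.2) * decayWeight (pairSum P - pairSum Q) ≤
        h P Q + h (P.1, -Q.1) (-P.2, Q.2) + h (P.1, -Q.2) (Q.1, -P.2) +
          (A P.1 * A P.2) * (A Q.1 * A Q.2) / √R := by
    rintro ⟨x, y⟩ hP ⟨z, w⟩ hQ
    have n1 := hnonneg (x, y) (z, w)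
    have n2 := hnonneg (x, -z) (-y, w)
    have n3 := hnonneg (x, -w) (z, -y)
    have n4 := div_nonneg (hnn (x, y) (z, w)) (Real.sqrt_nonneg R)
    dsimp only at n4 ⊢
    by_cases hclose : ‖pairSum (x, y) - pairSum (z, w)‖ ≤ R
    · have e2 : pairSum (x, -z) - pairSum (-y, w) = pairSum (x, y) - pairSum (z, w) := by
        simp only [pairSum, latC_neg]; ring
      have e3 : pairSum (x, -w) - pairSum (z, -y) = pairSum (x, y) - pairSum (z, w) := by
        simp only [pairSum, latC_neg]; ring
      rcases pairSum_cover hlam.le hT (Finset.mem_product.1 hP).1 hclose with hc | hc | hc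
      · have : h (x, y) (z, w) = A x * A y * (A z * A w) *
            decayWeight (pairSum (x, y) - pairSum (z, w)) := if_pos hc
        linarith
      · have : h (x, -z) (-y, w) = A x * A y * (A z * A w) *
            decayWeight (pairSum (x, y) - pairSum (z, w)) := by
          rw [hh]
          simp only [if_pos hc, hAneg, e2]
          ring
        linarith
      · have : h (x, -w) (z, -y) = A x * A y * (A z * A w) *
            decayWeight (pairSum (x, y) - pairSum (z, w)) := by
          rw [hh]
          simp only [if_pos hc, hAneg, e3]
          ring
        linarith
    · have : decayWeight (pairSum (x, y) - pairSum (z, w)) ≤ 1 / √R :=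
        one_div_le_one_div_of_le (Real.sqrt_pos.2 hR0)
          (Real.sqrt_le_sqrt (by linarith [not_le.1 hclose]))
      have := mul_le_mul_of_nonneg_left this (hnn (x, y) (z, w))
      rw [mul_one_div] at this
      dsimp only at this
      linarith
  have hnear := sum_nearPairs_le hR hR0 h2R A
  have hfar := div_le_div_of_nonneg_right (sum_product_mul_le (Elat lam) A) (Real.sqrt_nonneg R)
  refine (Finset.sum_le_sum fun P hP => Finset.sum_le_sum fun Q hQ => hterm P hP Q hQ).trans ?_
  simp only [Finset.sum_add_distrib, ← Finset.sum_div]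
  rw [sum_product_swap_neg_left hlam.le h, sum_product_swap_neg_right hlam.le h, add_mul,
    div_mul_eq_mul_div]
  linarith

theorem exists_card_Elat_sq_le : ∃ C : ℝ, 0 < C ∧ ∀ lam : ℝ, 0 < lam →
    ((Elat lam).card : ℝ) ^ 2 ≤ C * √√√lam := by
  obtain ⟨C, hC, hle⟩ := exists_ncard_gaussSphere_le (show (0 : ℝ) < 1 / 32 by norm_num)
  refine ⟨C ^ 2, by positivity, fun lam hlam => ?_⟩
  rcases (Elat lam).eq_empty_or_nonempty with h0 | ⟨μ, hμ⟩
  · rw [h0]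
    rw [Finset.card_empty, Nat.cast_zero, zero_pow two_ne_zero]
    positivity
  have hμ' := sq_add_sq_of_mem_Elat hμ
  obtain ⟨n, hn⟩ : ∃ n : ℕ, (n : ℤ) = μ.1 ^ 2 + μ.2 ^ 2 :=
    ⟨(μ.1 ^ 2 + μ.2 ^ 2).toNat, Int.toNat_of_nonneg (by positivity)⟩
  have hnl : (n : ℝ) = lam ^ 2 := by
    rw [← hμ']
    exact_mod_cast hn
  have hn0 : n ≠ 0 := by
    rintro rfl
    have := pow_pos hlam 2
    rw [← hnl] at this
    simp at this
  have hcard : (Elat lam).card ≤ (gaussSphere n).ncard := by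
    have hinj : Function.Injective (fun ξ : ℤ × ℤ => (⟨ξ.1, ξ.2⟩ : GaussianInt)) := by
      rintro ⟨a, b⟩ ⟨c, d⟩ h
      have h1 := congrArg Zsqrtd.re h
      have h2 := congrArg Zsqrtd.im h
      exact Prod.ext h1 h2
    rw [← Set.ncard_coe_finset, ← Set.ncard_image_of_injective _ hinj]
    refine Set.ncard_le_ncard ?_ (gaussSphere_finite n)
    rintro _ ⟨ξ, hξ, rfl⟩
    have hξ := sq_add_sq_of_mem_Elat (Finset.mem_coe.1 hξ)
    rw [← hnl] at hξ
    have : ξ.1 ^ 2 + ξ.2 ^ 2 = (n : ℤ) := by exact_mod_cast hξ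
    change Zsqrtd.norm _ = _
    rw [Zsqrtd.norm_def, ← this]
    ring
  have hN : ((Elat lam).card : ℝ) ≤ C * (n : ℝ) ^ (1 / 32 : ℝ) :=
    (Nat.cast_le.2 hcard).trans (hle n hn0)
  have hq : ((n : ℝ) ^ (1 / 32 : ℝ)) ^ 2 = √√√lam := by
    rw [hnl, Real.sqrt_eq_rpow, Real.sqrt_eq_rpow, Real.sqrt_eq_rpow, ← Real.rpow_natCast lam 2,
      ← Real.rpow_natCast _ 2, ← Real.rpow_mul hlam.le, ← Real.rpow_mul hlam.le,
      ← Real.rpow_mul hlam.le, ← Real.rpow_mul hlam.le]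
    norm_num
  calc _ ≤ (C * (n : ℝ) ^ (1 / 32 : ℝ)) ^ 2 := pow_le_pow_left₀ (Nat.cast_nonneg _) hN 2
    _ = _ := by rw [mul_pow, hq]

/-- Theorem 1.3: for a smooth curve with nowhere-zero curvature, the restriction `L⁴` norm
satisfies `∫_C |F|⁴ ≤ C₀ · B_lam · ‖F‖₂⁴`. -/
theorem restriction_L4_upper_bound
    (L Kmin Kmax : ℝ) (γ : ℝ → ℝ × ℝ)
    (hL : 0 < L) (hKmin : 0 < Kmin)
    (hsmooth : ContDiff ℝ (⊤ : ℕ∞) γ)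
    (hunit : ∀ t ∈ Set.Icc (0:ℝ) L, e2 (deriv γ t) = 1)
    (hcurv : ∀ t ∈ Set.Icc (0:ℝ) L,
      Kmin ≤ e2 (deriv (deriv γ) t) ∧ e2 (deriv (deriv γ) t) ≤ Kmax) :
    ∃ C0 > (0:ℝ), ∃ lam0 > (0:ℝ), ∀ lam : ℝ, lam0 ≤ lam →
      ∀ a : ℤ × ℤ → ℂ,
        (∀ μ : ℤ × ℤ, a (-μ) = starRingEnd ℂ (a μ)) →
        (∫ t in (0:ℝ)..L, ‖efn lam a (γ t)‖ ^ 4)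
          ≤ C0 * (Bmax lam : ℝ) * (l2T (efn lam a)) ^ 4 := by
  obtain ⟨C₁, hC₁, hdecay⟩ := exists_curve_decay hL hKmin hsmooth hunit hcurv
  obtain ⟨C₂, hC₂, hcard⟩ := exists_card_Elat_sq_le
  refine ⟨C₁ * (159120 + C₂), by positivity, 10 ^ 4, by norm_num, fun lam hlam a ha => ?_⟩
  refine (intervalIntegral_efn_pow_four_le lam L a hsmooth.continuous).trans ?_
  rcases (Elat lam).eq_empty_or_nonempty with h0 | ⟨μ, hμ⟩
  · simp only [h0, Finset.product_empty, Finset.sum_empty]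
    positivity
  have hlam0 : 0 < lam := by linarith
  set r := √lam with hr
  set R := √r with hRdef
  have hr2 : r ^ 2 = lam := Real.sq_sqrt hlam0.le
  have hR2 : R ^ 2 = r := Real.sq_sqrt (Real.sqrt_nonneg _)
  have hr100 : 100 ≤ r := Real.le_sqrt_of_sq_le (by linarith)
  have hR10 : 10 ≤ R := Real.le_sqrt_of_sq_le (by linarith)
  have hlamR : lam = R ^ 4 := by rw [← hr2, ← hR2]; ring
  have hR0 : 0 < R := by linarith
  have c1 : 4 * R ^ 3 < lam := by
    rw [hlamR, pow_succ R 3, mul_comm]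
    exact mul_lt_mul_of_pos_left (by linarith) (by positivity)
  have c2 : 2 * R ≤ r := by rw [← hR2]; nlinarith
  have c3 : 3 * (r * R) + 4 * R < 2 * lam := by
    rw [← hr2]
    nlinarith
  have hA : ∀ μ, ‖a (-μ)‖ = ‖a μ‖ := fun μ => by rw [ha, Complex.norm_conj]
  have hsum := sum_decayWeight_le c1 hR0 c2 c3 (A := fun μ => ‖a μ‖) (fun μ => norm_nonneg _) hA
  have hB : (1 : ℝ) ≤ Bmax lam := by exact_mod_cast one_le_Bmax hlam0.le hμ
  have hfar : ((Elat lam).card : ℝ) ^ 2 / √R ≤ C₂ := by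
    rw [div_le_iff₀ (Real.sqrt_pos.2 hR0)]
    exact hcard lam hlam0
  set S := ∑ μ ∈ Elat lam, ‖a μ‖ ^ 2 with hS
  have hl2 : S ^ 2 ≤ l2T (efn lam a) ^ 4 := by
    rw [show l2T (efn lam a) ^ 4 = (l2T (efn lam a) ^ 2) ^ 2 by ring, l2T_efn_sq]
    refine pow_le_pow_left₀ (Finset.sum_nonneg fun _ _ => sq_nonneg _) ?_ 2
    refine le_mul_of_one_le_left (Finset.sum_nonneg fun _ _ => sq_nonneg _) ?_
    nlinarith [Real.pi_gt_three]
  calc _ ≤ ∑ P ∈ Elat lam ×ˢ Elat lam, ∑ Q ∈ Elat lam ×ˢ Elat lam,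
        C₁ * ((‖a P.1‖ * ‖a P.2‖) * (‖a Q.1‖ * ‖a Q.2‖) *
          decayWeight (pairSum P - pairSum Q)) := by
        refine Finset.sum_le_sum fun P _ => Finset.sum_le_sum fun Q _ => ?_
        have := mul_le_mul_of_nonneg_left (hdecay (pairSum P - pairSum Q))
          (by positivity : 0 ≤ (‖a P.1‖ * ‖a P.2‖) * (‖a Q.1‖ * ‖a Q.2‖))
        refine this.trans (le_of_eq ?_)
        rw [decayWeight]
        ring
    _ = C₁ * ∑ P ∈ Elat lam ×ˢ Elat lam, ∑ Q ∈ Elat lam ×ˢ Elat lam,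
        (‖a P.1‖ * ‖a P.2‖) * (‖a Q.1‖ * ‖a Q.2‖) * decayWeight (pairSum P - pairSum Q) := by
        simp only [← Finset.mul_sum]
    _ ≤ C₁ * ((159120 * Bmax lam + C₂ * Bmax lam) * S ^ 2) := by
        refine mul_le_mul_of_nonneg_left (hsum.trans ?_) hC₁.le
        refine mul_le_mul_of_nonneg_right ?_ (sq_nonneg _)
        nlinarith
    _ = C₁ * (159120 + C₂) * Bmax lam * S ^ 2 := by ring
    _ ≤ _ := by gcongr
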